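/- arXiv:1202.3931 — 3 statements merged into one kernel-verified Lean document; each statement's English description precedes it below -/
import Mathlib

section
/- Let S_a be a non-singular subdivision scheme with dilation mI, |m| ≥ 2, with parameter values t^{(r)}_α associated with some offset τ ∈ ℝ^s, and let k ∈ ℕ_0. Then S_a is step-wise polynomial reproducing up to degree k (i.e., for every polynomial π of total degree ≤ k and every r ≥ 0, (S_a (π(t^{(r)}_·)))_α = π(t^{(r+1)}_α) for all α ∈ ℤ^s) if and only if S_a is polynomial reproducing up to degree k (i.e., for every polynomial π of total degree ≤ k, the scheme converges from the initial data (π(t^{(0)}_α))_{α∈ℤ^s} = (π(α))_{α∈ℤ^s} to the limit function π). -/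
open Finset Filter

noncomputable section

/-- Sequences indexed by `ℤ^s`. -/
abbrev ZS (s : ℕ) := Fin s → ℤ

/-- `z^α = z_1^{α_1} ⋯ z_s^{α_s}` for `z ∈ ℂ^s`, `α ∈ ℤ^s`. -/
def zpowV {s : ℕ} (z : Fin s → ℂ) (α : Fin s → ℤ) : ℂ := ∏ i, z i ^ α i

/-- The tensor-product falling factorial polynomial
`q_j(x) = ∏_i ∏_{ℓ=0}^{j_i-1} (x_i - ℓ)` (complex version). -/
def qpolyC {s : ℕ} (j : Fin s → ℕ) (x : Fin s → ℂ) : ℂ :=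
  ∏ i, ∏ l ∈ Finset.range (j i), (x i - l)

/-- The tensor-product falling factorial polynomial (real version). -/
def qpolyR {s : ℕ} (j : Fin s → ℕ) (x : Fin s → ℝ) : ℝ :=
  ∏ i, ∏ l ∈ Finset.range (j i), (x i - l)

/-- `(D^j a)(z) = ∑_α q_j(α) a_α z^{α-j}`, the `j`-th iterated partial derivative of the symbol
`a(z) = ∑_α a_α z^α`.  For `j = 0` this is the symbol itself. -/
def symbolD {s : ℕ} (a : ZS s → ℝ) (j : Fin s → ℕ) (z : Fin s → ℂ) : ℂ :=
  ∑ᶠ α : ZS s, qpolyC j (fun i => (α i : ℂ)) * (a α : ℂ) * zpowV z (fun i => α i - (j i : ℤ))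

/-- The point `(1,…,1) ∈ ℂ^s`. -/
def onesC {s : ℕ} : Fin s → ℂ := fun _ => 1

/-- `e ∈ E = {0,…,|m|-1}^s`. -/
def inE {s : ℕ} (m : ℤ) (e : ZS s) : Prop := ∀ i, 0 ≤ e i ∧ e i < |m|

/-- `ε_e = (e^{-2πi e_1/m}, …, e^{-2πi e_s/m}) ∈ ℂ^s`. -/
def epsPt {s : ℕ} (m : ℤ) (e : ZS s) : Fin s → ℂ :=
  fun i => Complex.exp (-(2 * Real.pi * Complex.I * e i) / m)

/-- The subdivision operator `(S_a d)_α = ∑_β a_{α-mβ} d_β`. -/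
def subdOp {s : ℕ} (m : ℤ) (a : ZS s → ℝ) (d : ZS s → ℝ) : ZS s → ℝ :=
  fun α => ∑ᶠ β : ZS s, a (α - m • β) * d β

/-- The parameter values `t^{(r)}_α = α/m^r - τ ∑_{i=1}^r m^{-i}` attached to the data at
level `r`. -/
def param {s : ℕ} (m : ℤ) (τ : Fin s → ℝ) (r : ℕ) (α : ZS s) : Fin s → ℝ :=
  fun i => (α i : ℝ) / (m : ℝ) ^ r - τ i * ∑ n ∈ Finset.range r, ((m : ℝ) ^ (n + 1))⁻¹

/-- The subdivision scheme `S_a` (with dilation `mI` and parametrization offset `τ`) converges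
from initial data `d` to the limit `g`: there are continuous functions `F^{(r)}` interpolating
the data `S_a^r d` at the parameter values `t^{(r)}`, converging uniformly to `g`. -/
def ConvergesTo {s : ℕ} (m : ℤ) (a : ZS s → ℝ) (τ : Fin s → ℝ)
    (d : ZS s → ℝ) (g : (Fin s → ℝ) → ℝ) : Prop :=
  ∃ F : ℕ → (Fin s → ℝ) → ℝ,
    (∀ r, Continuous (F r)) ∧
    (∀ r α, F r (param m τ r α) = (subdOp m a)^[r] d α) ∧
    TendstoUniformly F g atTop

/-- Bounded data. -/
def Bdd {s : ℕ} (d : ZS s → ℝ) : Prop := ∃ C, ∀ α, |d α| ≤ C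

/-- The subdivision scheme is convergent: every bounded initial data admits a limit. -/
def Convergent {s : ℕ} (m : ℤ) (a : ZS s → ℝ) (τ : Fin s → ℝ) : Prop :=
  ∀ d, Bdd d → ∃ g, ConvergesTo m a τ d g

/-- The subdivision scheme is non-singular: it is convergent and a zero limit forces zero data. -/
def NonSingular {s : ℕ} (m : ℤ) (a : ZS s → ℝ) (τ : Fin s → ℝ) : Prop :=
  Convergent m a τ ∧
  ∀ d, Bdd d → ∀ g, ConvergesTo m a τ d g → g = 0 → (∀ α, d α = 0)

/-- `S_a` reproduces polynomials up to degree `k`: for every `s`-variate real polynomial `π` of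
total degree at most `k`, the scheme converges from the data `(π(α))_α` to the limit `π`. -/
def Reproduces {s : ℕ} (m : ℤ) (a : ZS s → ℝ) (τ : Fin s → ℝ) (k : ℕ) : Prop :=
  ∀ π : MvPolynomial (Fin s) ℝ, π.totalDegree ≤ k →
    ConvergesTo m a τ (fun α => MvPolynomial.eval (fun i => (α i : ℝ)) π)
      (fun x => MvPolynomial.eval x π)

/-- `S_a` is step-wise polynomial reproducing up to degree `k`:
`S_a (π(t^{(r)}_·)) = π(t^{(r+1)}_·)` for every polynomial `π` of total degree at most `k`. -/
def StepwiseReproduces {s : ℕ} (m : ℤ) (a : ZS s → ℝ) (τ : Fin s → ℝ) (k : ℕ) : Prop :=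
  ∀ π : MvPolynomial (Fin s) ℝ, π.totalDegree ≤ k → ∀ r : ℕ, ∀ α : ZS s,
    subdOp m a (fun β => MvPolynomial.eval (param m τ r β) π) α
      = MvPolynomial.eval (param m τ (r + 1) α) π

/-- Condition `Z_k`: `a(1,…,1) = |m|^s` and `(D^j a)(ε) = 0` for all `ε ∈ Ξ'` and `|j| < k`. -/
def CondZ {s : ℕ} (m : ℤ) (a : ZS s → ℝ) (k : ℕ) : Prop :=
  symbolD a 0 onesC = ((|m| : ℤ) : ℂ) ^ s ∧
  ∀ e : ZS s, inE m e → e ≠ 0 → ∀ j : Fin s → ℕ, (∑ i, j i) < k →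
    symbolD a j (epsPt m e) = 0

/-- The polynomials of total degree less than `n` (only the zero polynomial for `n = 0`). -/
abbrev degLT (σ : Type*) (n : ℕ) : Submodule ℝ (MvPolynomial σ ℝ) :=
  MvPolynomial.restrictSupport ℝ {d | d.degree < n}

lemma mem_degLT_succ_iff {σ : Type*} {n : ℕ} {p : MvPolynomial σ ℝ} :
    p ∈ degLT σ (n + 1) ↔ p.totalDegree ≤ n := by
  rw [MvPolynomial.mem_restrictSupport_iff, MvPolynomial.totalDegree, Finset.sup_le_iff]
  exact forall₂_congr fun d _ => Nat.lt_succ_iff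

lemma degLT_mono {σ : Type*} {n k : ℕ} (h : n ≤ k) : degLT σ n ≤ degLT σ k :=
  MvPolynomial.restrictSupport_mono _ fun _ hd => lt_of_lt_of_le hd h

lemma mul_mem_degLT {σ : Type*} {n k : ℕ} {p q : MvPolynomial σ ℝ}
    (hp : p ∈ degLT σ n) (hq : q ∈ degLT σ (k + 1)) : p * q ∈ degLT σ (n + k) := by
  have h := Submodule.mul_mem_mul hp hq
  rw [← MvPolynomial.restrictSupport_add] at h
  refine MvPolynomial.restrictSupport_mono _ ?_ h
  rintro _ ⟨d, hd, e, he, rfl⟩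
  simp only [Set.mem_ofPred_eq, map_add] at *
  omega

/-- The substitution `x ↦ c x + b` in polynomials. -/
def affSubst {σ : Type*} (c : ℝ) (b : σ → ℝ) : MvPolynomial σ ℝ →ₐ[ℝ] MvPolynomial σ ℝ :=
  MvPolynomial.bind₁ fun i => MvPolynomial.C c * MvPolynomial.X i + MvPolynomial.C (b i)

lemma eval_affSubst {σ : Type*} (c : ℝ) (b : σ → ℝ) (p : MvPolynomial σ ℝ) (x : σ → ℝ) :
    MvPolynomial.eval x (affSubst c b p) = MvPolynomial.eval (fun i => c * x i + b i) p := by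
  simp only [affSubst, MvPolynomial.eval, MvPolynomial.eval₂Hom_bind₁]
  congr 2
  ext i
  simp

lemma monomial_mem_degLT {σ : Type*} (d : σ →₀ ℕ) (r : ℝ) :
    MvPolynomial.monomial d r ∈ degLT σ (d.degree + 1) := by
  simp [MvPolynomial.monomial_mem_restrictSupport]

/-- An affine substitution multiplies the leading part of a monomial by a power of `c`. -/
lemma affSubst_monomial_sub_mem {σ : Type*} (c : ℝ) (b : σ → ℝ) (d : σ →₀ ℕ) :
    affSubst c b (MvPolynomial.monomial d 1) - MvPolynomial.monomial d (c ^ d.degree)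
      ∈ degLT σ d.degree := by
  induction d using Finsupp.induction_linear with
  | zero => simp
  | add f g hf hg =>
    have hg' : affSubst c b (MvPolynomial.monomial g 1) ∈ degLT σ (g.degree + 1) := by
      have := add_mem (degLT_mono (Nat.le_succ _) hg) (monomial_mem_degLT g (c ^ g.degree))
      rwa [sub_add_cancel] at this
    have h₁ := mul_mem_degLT hf hg'
    have h₂ := mul_mem_degLT hg (monomial_mem_degLT f (c ^ f.degree))
    rw [add_comm g.degree] at h₂
    have h := add_mem h₁ h₂
    have e₁ : (MvPolynomial.monomial (f + g) (1 : ℝ))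
        = MvPolynomial.monomial f 1 * MvPolynomial.monomial g 1 := by
      simp [MvPolynomial.monomial_mul]
    have e₂ : (MvPolynomial.monomial (f + g) (c ^ (f + g).degree))
        = MvPolynomial.monomial f (c ^ f.degree) * MvPolynomial.monomial g (c ^ g.degree) := by
      simp [MvPolynomial.monomial_mul, pow_add]
    rw [e₁, e₂, map_mul, map_add]
    convert h using 1
    ring
  | single i n =>
    have hX : affSubst c b (MvPolynomial.X i) =
        MvPolynomial.C c * MvPolynomial.X i + MvPolynomial.C (b i) := by simp [affSubst]
    induction n with
    | zero => simp
    | succ n ih =>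
      have h₀ : MvPolynomial.C c * MvPolynomial.X i + MvPolynomial.C (b i) ∈ degLT σ (1 + 1) := by
        refine mem_degLT_succ_iff.2 ((MvPolynomial.totalDegree_add _ _).trans (max_le ?_ ?_))
        · exact (MvPolynomial.totalDegree_mul _ _).trans (by simp)
        · simp
      have h₁ := mul_mem_degLT ih h₀
      have hC : (MvPolynomial.C (b i) : MvPolynomial σ ℝ) ∈ degLT σ 1 :=
        mem_degLT_succ_iff.2 (by simp)
      have h₂ := mul_mem_degLT hC (monomial_mem_degLT (Finsupp.single i n) (c ^ n))
      rw [add_comm 1] at h₂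
      have h := add_mem h₁ h₂
      simp only [Finsupp.degree_single] at h ⊢
      have e₁ : (MvPolynomial.monomial (Finsupp.single i (n + 1)) (1 : ℝ))
          = MvPolynomial.monomial (Finsupp.single i n) 1 * MvPolynomial.X i := by
        simp [MvPolynomial.X, MvPolynomial.monomial_mul, Finsupp.single_add]
      have e₂ : (MvPolynomial.monomial (Finsupp.single i (n + 1)) (c ^ (n + 1)))
          = MvPolynomial.monomial (Finsupp.single i n) (c ^ n)
            * (MvPolynomial.C c * MvPolynomial.X i) := by
        simp [MvPolynomial.X, MvPolynomial.monomial_mul, Finsupp.single_add, pow_succ,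
          MvPolynomial.C_mul_monomial]
      rw [e₁, e₂, map_mul, hX]
      convert h using 1
      ring

/-- A family of polynomials that contains the images of all monomials of degree less than `n`
under a linear map contains the images of all polynomials of degree less than `n`. -/
lemma map_mem_of_monomial {σ M : Type*} [AddCommGroup M] [Module ℝ M] {n : ℕ}
    (L : MvPolynomial σ ℝ →ₗ[ℝ] M) (V : Submodule ℝ M)
    (h : ∀ d : σ →₀ ℕ, d.degree < n → L (MvPolynomial.monomial d 1) ∈ V)
    {p : MvPolynomial σ ℝ} (hp : p ∈ degLT σ n) : L p ∈ V := by
  rw [degLT, MvPolynomial.restrictSupport_eq_span] at hp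
  have : Submodule.span ℝ ((MvPolynomial.monomial · (1 : ℝ)) '' {d : σ →₀ ℕ | d.degree < n})
      ≤ V.comap L := by
    rw [Submodule.span_le]
    rintro _ ⟨d, hd, rfl⟩
    exact h d hd
  exact this hp

lemma affSubst_mem_degLT {σ : Type*} {n : ℕ} (c : ℝ) (b : σ → ℝ) {p : MvPolynomial σ ℝ}
    (hp : p ∈ degLT σ n) : affSubst c b p ∈ degLT σ n := by
  refine map_mem_of_monomial (affSubst c b).toLinearMap _ (fun d hd => ?_) hp
  have := add_mem (degLT_mono (Nat.le_succ _) (affSubst_monomial_sub_mem c b d))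
    (monomial_mem_degLT d (c ^ d.degree))
  rw [sub_add_cancel] at this
  exact degLT_mono hd this

/-- Finite differences lower the degree. -/
lemma affSubst_one_sub_mem_degLT {σ : Type*} {n : ℕ} (b : σ → ℝ) {p : MvPolynomial σ ℝ}
    (hp : p ∈ degLT σ (n + 1)) : affSubst 1 b p - p ∈ degLT σ n := by
  refine map_mem_of_monomial ((affSubst 1 b).toLinearMap - LinearMap.id) _ (fun d hd => ?_) hp
  have := affSubst_monomial_sub_mem 1 b d
  rw [one_pow] at this
  exact degLT_mono (Nat.lt_succ_iff.1 hd) this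

/-- The restriction of a polynomial to `ℤ^s`. -/
def evalZ {s : ℕ} (p : MvPolynomial (Fin s) ℝ) : ZS s → ℝ :=
  fun α => MvPolynomial.eval (fun i => (α i : ℝ)) p

section Subdivision

variable {s : ℕ} {m : ℤ} {a : ZS s → ℝ}

lemma finite_support_subdOp_summand (hm : m ≠ 0) (ha : (Function.support a).Finite)
    (d : ZS s → ℝ) (α : ZS s) :
    (Function.support fun β : ZS s => a (α - m • β) * d β).Finite := by
  have hinj : Function.Injective fun β : ZS s => α - m • β := fun β γ h =>
    smul_right_injective _ hm (sub_right_injective h)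
  refine (ha.preimage hinj.injOn).subset fun β hβ => ?_
  exact left_ne_zero_of_mul hβ

lemma subdOp_sub (hm : m ≠ 0) (ha : (Function.support a).Finite) (d d' : ZS s → ℝ) :
    subdOp m a (d - d') = subdOp m a d - subdOp m a d' := by
  funext α
  simp only [subdOp, Pi.sub_apply, mul_sub]
  exact finsum_sub_distrib (finite_support_subdOp_summand hm ha d α)
    (finite_support_subdOp_summand hm ha d' α)

lemma iterate_subdOp_sub (hm : m ≠ 0) (ha : (Function.support a).Finite) (r : ℕ)
    (d d' : ZS s → ℝ) :
    (subdOp m a)^[r] (d - d') = (subdOp m a)^[r] d - (subdOp m a)^[r] d' := by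
  induction r generalizing d d' with
  | zero => rfl
  | succ r ih => simp only [Function.iterate_succ_apply, subdOp_sub hm ha, ih]

lemma subdOp_add_smul (d : ZS s → ℝ) (α γ : ZS s) :
    subdOp m a d (α + m • γ) = subdOp m a (fun β => d (β + γ)) α := by
  simp only [subdOp]
  rw [← finsum_comp_equiv (Equiv.addRight γ)]
  refine finsum_congr fun β => ?_
  simp only [Equiv.coe_addRight, smul_add, add_sub_add_right_eq_sub]

lemma bdd_of_periodic (hm : m ≠ 0) {e : ZS s → ℝ} (he : ∀ α γ, e (α + m • γ) = e α) : Bdd e := by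
  have hfin : ((fun α => |e α|) '' Set.Icc (0 : ZS s) (fun _ => |m|)).Finite :=
    (Set.finite_Icc _ _).image _
  obtain ⟨C, hC⟩ := hfin.bddAbove
  refine ⟨C, fun α => ?_⟩
  have h : e α = e fun i => α i % m := by
    rw [← he (fun i => α i % m) (fun i => α i / m)]
    congr 1
    funext i
    simp [Int.emod_add_mul_ediv]
  rw [h]
  exact hC ⟨_, ⟨fun i => Int.emod_nonneg _ hm, fun i => (Int.emod_lt_abs _ hm).le⟩, rfl⟩

lemma param_zero (τ : Fin s → ℝ) (α : ZS s) : param m τ 0 α = fun i => (α i : ℝ) := by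
  funext i
  simp [param]

lemma param_succ (τ : Fin s → ℝ) (r : ℕ) (α : ZS s) :
    param m τ (r + 1) α = fun i => (m : ℝ)⁻¹ * param m τ r α i + -(τ i / m) := by
  funext i
  simp only [param, Finset.sum_range_succ', zero_add, pow_one]
  have : ∑ n ∈ Finset.range r, ((m : ℝ) ^ (n + 1 + 1))⁻¹
      = (m : ℝ)⁻¹ * ∑ n ∈ Finset.range r, ((m : ℝ) ^ (n + 1))⁻¹ := by
    rw [Finset.mul_sum]
    exact Finset.sum_congr rfl fun n _ => by rw [pow_succ _ (n + 1), mul_inv, mul_comm]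
  rw [this, pow_succ, div_mul_eq_div_div]
  ring

lemma param_eq_affine (τ : Fin s → ℝ) (r : ℕ) (α : ZS s) :
    param m τ r α = fun i => ((m : ℝ) ^ r)⁻¹ * (α i : ℝ)
      + -(τ i * ∑ n ∈ Finset.range r, ((m : ℝ) ^ (n + 1))⁻¹) := by
  funext i
  simp only [param]
  ring

lemma param_succ_eq_affine (hm : m ≠ 0) (τ : Fin s → ℝ) (r : ℕ) (α : ZS s) :
    param m τ (r + 1) α = fun i => ((m : ℝ) ^ r)⁻¹ * param m τ 1 α i
      + -(τ i * ∑ n ∈ Finset.range r, ((m : ℝ) ^ (n + 1))⁻¹) := by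
  have hm' : (m : ℝ) ≠ 0 := Int.cast_ne_zero.2 hm
  funext i
  simp only [param, Finset.sum_range_succ, Finset.range_zero, Finset.sum_empty, zero_add, pow_one]
  field_simp
  ring

lemma ConvergesTo.sub (hm : m ≠ 0) (ha : (Function.support a).Finite) {τ : Fin s → ℝ}
    {d d' : ZS s → ℝ} {g g' : (Fin s → ℝ) → ℝ} (h : ConvergesTo m a τ d g)
    (h' : ConvergesTo m a τ d' g') : ConvergesTo m a τ (d - d') (g - g') := by
  obtain ⟨F, hF, hFd, hFg⟩ := h
  obtain ⟨G, hG, hGd, hGg⟩ := h'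
  refine ⟨F - G, fun r => (hF r).sub (hG r), fun r α => ?_, hFg.sub hGg⟩
  simp [iterate_subdOp_sub hm ha, hFd, hGd]

/-- Starting one level later amounts to an affine reparametrization of the limit. -/
lemma ConvergesTo.step {τ : Fin s → ℝ} {d : ZS s → ℝ} {g : (Fin s → ℝ) → ℝ}
    (h : ConvergesTo m a τ d g) :
    ConvergesTo m a τ (subdOp m a d) fun x => g fun i => (m : ℝ)⁻¹ * x i + -(τ i / m) := by
  obtain ⟨F, hF, hFd, hFg⟩ := h
  refine ⟨fun r x => F (r + 1) fun i => (m : ℝ)⁻¹ * x i + -(τ i / m),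
    fun r => (hF _).comp (by fun_prop), fun r α => ?_, ?_⟩
  · beta_reduce
    rw [← param_succ, hFd, Function.iterate_succ_apply]
  · intro u hu
    filter_upwards [(tendsto_add_atTop_nat 1).eventually (hFg u hu)] with r hr x using hr _

lemma StepwiseReproduces.iterate {τ : Fin s → ℝ} {k : ℕ} (h : StepwiseReproduces m a τ k)
    {p : MvPolynomial (Fin s) ℝ} (hp : p.totalDegree ≤ k) (r : ℕ) :
    (subdOp m a)^[r] (evalZ p) = fun α => MvPolynomial.eval (param m τ r α) p := by
  induction r with
  | zero =>
    funext α
    simp [param_zero, evalZ]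
  | succ r ih =>
    rw [Function.iterate_succ_apply', ih]
    exact funext (h p hp r)

/-- For non-singular schemes, polynomial reproduction implies the first refinement step reproduces
polynomials at the parameter values. -/
lemma Reproduces.subdOp_evalZ (hm : m ≠ 0) (ha : (Function.support a).Finite) {τ : Fin s → ℝ}
    (hns : NonSingular m a τ) {k : ℕ} (h : Reproduces m a τ k) (n : ℕ) (hn : n ≤ k + 1) :
    ∀ p ∈ degLT (Fin s) n, ∀ α,
      subdOp m a (evalZ p) α = MvPolynomial.eval (param m τ 1 α) p := by
  induction n with
  | zero =>
    intro p hp α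
    have : p = 0 := by
      simpa [MvPolynomial.mem_restrictSupport_iff] using hp
    simp [this, evalZ, subdOp]
  | succ n ih =>
    intro p hp α
    set q := affSubst (m : ℝ)⁻¹ (fun i => -(τ i / m)) p with hq
    have hqp : ∀ β : ZS s, evalZ q β = MvPolynomial.eval (param m τ 1 β) p := fun β => by
      rw [evalZ, hq, eval_affSubst, param_succ, param_zero]
    have hpk : p.totalDegree ≤ k := (mem_degLT_succ_iff.1 hp).trans (by omega)
    have hqk : q.totalDegree ≤ k :=
      (mem_degLT_succ_iff.1 (affSubst_mem_degLT _ _ hp)).trans (by omega)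
    have hconv := (h p hpk).step.sub hm ha (h q hqk)
    have hper : ∀ β γ, (subdOp m a (evalZ p) - evalZ q) (β + m • γ)
        = (subdOp m a (evalZ p) - evalZ q) β := by
      intro β γ
      have hΔ := ih (by omega) _ (affSubst_one_sub_mem_degLT (fun i => (γ i : ℝ)) hp) β
      have e₁ : evalZ (affSubst 1 (fun i => (γ i : ℝ)) p - p)
          = (fun δ => evalZ p (δ + γ)) - evalZ p := by
        funext δ
        simp [evalZ, eval_affSubst]
      have e₂ : param m τ 1 (β + m • γ) = fun i => 1 * param m τ 1 β i + (γ i : ℝ) := by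
        have hm' : (m : ℝ) ≠ 0 := Int.cast_ne_zero.2 hm
        funext i
        simp [param]
        field_simp
        ring
      rw [e₁, subdOp_sub hm ha, map_sub, eval_affSubst, Pi.sub_apply] at hΔ
      rw [Pi.sub_apply, Pi.sub_apply, subdOp_add_smul, hqp, hqp, e₂]
      linarith
    have hzero := hns.2 _ (bdd_of_periodic hm hper) _ hconv (by
      funext x
      simp [hq, eval_affSubst]) α
    rw [← hqp]
    exact sub_eq_zero.1 hzero

end Subdivision

/-- For a non-singular subdivision scheme, step-wise polynomial reproduction
up to degree `k` is equivalent to polynomial reproduction up to degree `k`. -/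
theorem stmt1 {s : ℕ} (hs : 1 ≤ s) (m : ℤ) (hm : 2 ≤ |m|)
    (a : ZS s → ℝ) (ha : (Function.support a).Finite)
    (τ : Fin s → ℝ) (hns : NonSingular m a τ) (k : ℕ) :
    StepwiseReproduces m a τ k ↔ Reproduces m a τ k := by
  have hm0 : m ≠ 0 := by
    rintro rfl
    simp at hm
  constructor
  · intro h π hπ
    refine ⟨fun _ x => MvPolynomial.eval x π, fun _ => π.continuous_eval, fun r α => ?_,
      fun u hu => Eventually.of_forall fun _ x => refl_mem_uniformity hu⟩
    exact (congrFun (h.iterate hπ r) α).symm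
  · intro h π hπ r α
    have hmem := affSubst_mem_degLT ((m : ℝ) ^ r)⁻¹
      (fun i => -(τ i * ∑ n ∈ Finset.range r, ((m : ℝ) ^ (n + 1))⁻¹)) (mem_degLT_succ_iff.2 hπ)
    have key := h.subdOp_evalZ hm0 ha hns (k + 1) le_rfl _ hmem α
    rw [eval_affSubst, ← param_succ_eq_affine hm0] at key
    rw [← key]
    congr 1
    funext β
    rw [evalZ, eval_affSubst, param_eq_affine]

end
end

section
/- Let a : ℤ^s → ℝ be a finitely supported mask with dilation mI, |m| ≥ 2, let k ∈ ℕ and τ ∈ ℝ^s. Then the conditions (D^j a)(1,…,1) = |m|^s q_j(τ) and (D^j a)(ε) = 0 for all ε ∈ Ξ′, for every multi-index j ∈ ℕ_0^s with |j| ≤ k, hold if and only if for every α ∈ ℤ^s and every j ∈ ℕ_0^s with |j| ≤ k, Σ_{β∈ℤ^s} a_{α−mβ} β^j = ((α−τ)/m)^j, where x^j = x_1^{j_1}⋯x_s^{j_s}. -/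
open Finset Filter

noncomputable section

open Polynomial in
/-- Polynomials `p 0, …, p (n - 1)` with `deg (p l) = l` span the polynomials of degree `< n`. -/
theorem exists_eq_sum_C_mul_of_degree_eq {K : Type*} [Field K] (p : ℕ → K[X])
    (hp : ∀ n, (p n).degree = n) (n : ℕ) (r : K[X]) (hr : r.degree < n) :
    ∃ c : ℕ → K, r = ∑ l ∈ range n, C (c l) * p l := by
  induction n generalizing r with
  | zero =>
    refine ⟨0, ?_⟩
    have hr0 : r.degree < 0 := by simpa using hr
    simpa using hr0
  | succ n ih =>
    have hlead : (p n).coeff n ≠ 0 := by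
      have hne : p n ≠ 0 := by
        intro h
        have := hp n
        simp [h] at this
      have := leadingCoeff_ne_zero.mpr hne
      rwa [leadingCoeff, natDegree_eq_of_degree_eq_some (hp n)] at this
    have hdeg : (r - C (r.coeff n / (p n).coeff n) * p n).degree < n := by
      rw [degree_lt_iff_coeff_zero] at hr ⊢
      intro d hd
      rw [coeff_sub, coeff_C_mul]
      rcases hd.eq_or_lt with rfl | hd
      · field_simp
        ring
      · rw [hr d hd, coeff_eq_zero_of_degree_lt (p := p n) (n := d) (by rw [hp n]; exact_mod_cast hd)]
        ring
    obtain ⟨c, hc⟩ := ih _ hdeg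
    refine ⟨fun l => if l = n then r.coeff n / (p n).coeff n else c l, ?_⟩
    rw [sum_range_succ]
    beta_reduce
    rw [if_pos rfl, ← sub_eq_iff_eq_add, hc]
    refine sum_congr rfl fun l hl => ?_
    rw [if_neg (mem_range.mp hl).ne]

open Polynomial in
/-- A linear functional that vanishes on the tensor products of total degree at most `k` built from
one graded family of univariate polynomials vanishes on those built from any other one. -/
theorem map_prod_eval_eq_zero_of_degree_eq {ι K : Type*} [Fintype ι] [Field K]
    (L : ((ι → K) → K) →ₗ[K] K) (p r : ι → ℕ → K[X])
    (hp : ∀ i n, (p i n).degree = n) (hr : ∀ i n, (r i n).degree = n) (k : ℕ)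
    (h : ∀ j : ι → ℕ, ∑ i, j i ≤ k → L (fun x => ∏ i, (p i (j i)).eval (x i)) = 0)
    (j : ι → ℕ) (hj : ∑ i, j i ≤ k) :
    L (fun x => ∏ i, (r i (j i)).eval (x i)) = 0 := by
  classical
  have hc (i : ι) : ∃ c : ℕ → K, r i (j i) = ∑ l ∈ range (j i + 1), C (c l) * p i l :=
    exists_eq_sum_C_mul_of_degree_eq (p i) (hp i) _ _ (by
      rw [hr]; exact_mod_cast Nat.lt_succ_self (j i))
  choose c hc using hc
  have hexp : (fun x : ι → K => ∏ i, (r i (j i)).eval (x i)) =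
      ∑ l ∈ Fintype.piFinset fun i => range (j i + 1),
        (∏ i, c i (l i)) • fun x : ι → K => ∏ i, (p i (l i)).eval (x i) := by
    funext x
    simp_rw [hc, eval_finsetSum, eval_mul, eval_C, prod_univ_sum]
    simp [prod_mul_distrib]
  rw [hexp, map_sum]
  refine sum_eq_zero fun l hl => ?_
  rw [map_smul, h l, smul_zero]
  refine le_trans (sum_le_sum fun i _ => ?_) hj
  have := Fintype.mem_piFinset.mp hl i
  rw [mem_range] at this
  omega

theorem zpowV_add {s : ℕ} {z : Fin s → ℂ} (hz : ∀ i, z i ≠ 0) (α β : ZS s) :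
    zpowV z (α + β) = zpowV z α * zpowV z β := by
  simp only [zpowV, Pi.add_apply, zpow_add₀ (hz _), prod_mul_distrib]

theorem zpowV_ne_zero {s : ℕ} {z : Fin s → ℂ} (hz : ∀ i, z i ≠ 0) (α : ZS s) :
    zpowV z α ≠ 0 :=
  prod_ne_zero_iff.mpr fun i _ => zpow_ne_zero _ (hz i)

theorem epsPt_ne_zero {s : ℕ} (m : ℤ) (e : ZS s) (i : Fin s) : epsPt m e i ≠ 0 :=
  Complex.exp_ne_zero _

theorem epsPt_zero {s : ℕ} (m : ℤ) : epsPt m (0 : ZS s) = onesC := by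
  funext i
  simp [epsPt, onesC]

theorem zpowV_epsPt_comm {s : ℕ} (m : ℤ) (e α : ZS s) :
    zpowV (epsPt m e) α = zpowV (epsPt m α) e := by
  refine prod_congr rfl fun i _ => ?_
  simp only [epsPt, ← Complex.exp_int_mul]
  congr 1
  ring

theorem zpow_abs_eq_one_of_zpow_eq_one {w : ℂ} {m : ℤ} (h : w ^ m = 1) : w ^ |m| = 1 := by
  rcases abs_choice m with hm | hm <;> simp [hm, h]

theorem exp_zpow_eq_one {m : ℤ} (hm : m ≠ 0) (x : ℤ) :
    Complex.exp (-(2 * Real.pi * Complex.I * x) / m) ^ m = 1 := by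
  have hm' : (m : ℂ) ≠ 0 := by exact_mod_cast hm
  rw [← Complex.exp_int_mul, mul_div_cancel₀ _ hm', Complex.exp_eq_one_iff]
  exact ⟨-x, by push_cast; ring⟩

theorem exp_eq_one_iff_dvd {m : ℤ} (hm : m ≠ 0) (x : ℤ) :
    Complex.exp (-(2 * Real.pi * Complex.I * x) / m) = 1 ↔ m ∣ x := by
  have hm' : (m : ℂ) ≠ 0 := by exact_mod_cast hm
  have hπ : (2 * Real.pi * Complex.I : ℂ) ≠ 0 := Complex.two_pi_I_ne_zero
  rw [Complex.exp_eq_one_iff]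
  constructor
  · rintro ⟨n, hn⟩
    rw [div_eq_iff hm'] at hn
    have h : (2 * Real.pi * Complex.I : ℂ) * x = (2 * Real.pi * Complex.I) * (m * (-n : ℤ)) := by
      push_cast
      linear_combination -hn
    exact ⟨-n, by exact_mod_cast mul_left_cancel₀ hπ h⟩
  · rintro ⟨n, rfl⟩
    refine ⟨-n, ?_⟩
    push_cast
    field_simp

theorem zpowV_epsPt_eq_of_dvd {s : ℕ} {m : ℤ} (hm : m ≠ 0) (e : ZS s) {α γ : ZS s}
    (h : ∀ i, m ∣ α i - γ i) : zpowV (epsPt m e) α = zpowV (epsPt m e) γ := by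
  refine prod_congr rfl fun i _ => ?_
  obtain ⟨n, hn⟩ := h i
  rw [sub_eq_iff_eq_add.mp hn, zpow_add₀ (epsPt_ne_zero m e i), zpow_mul, epsPt,
    exp_zpow_eq_one hm, one_zpow, one_mul]

/-- The set `E = {0, …, |m| - 1}^s` as a finset. -/
def boxE (s : ℕ) (m : ℤ) : Finset (ZS s) := Fintype.piFinset fun _ => Finset.Ico 0 |m|

theorem mem_boxE {s : ℕ} {m : ℤ} {e : ZS s} : e ∈ boxE s m ↔ inE m e := by
  simp [boxE, inE]

/-- The sum over a full period of the powers of an `m`-th root of unity. -/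
theorem sum_Ico_zpow {m : ℤ} {w : ℂ} (hw : w ^ m = 1) :
    ∑ n ∈ Finset.Ico 0 |m|, w ^ n = if w = 1 then ((|m| : ℤ) : ℂ) else 0 := by
  have hsum : ∑ n ∈ Finset.Ico 0 |m|, w ^ n = ∑ n ∈ range m.natAbs, w ^ n := by
    symm
    refine sum_bij (fun n _ => (n : ℤ)) ?_ ?_ ?_ ?_
    · intro n hn
      rw [mem_range] at hn
      rw [Finset.mem_Ico, Int.abs_eq_natAbs]
      omega
    · intro n _ n' _ h
      exact_mod_cast h
    · intro n hn
      rw [Finset.mem_Ico, Int.abs_eq_natAbs] at hn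
      exact ⟨n.toNat, by rw [mem_range]; omega, by omega⟩
    · intro n _
      simp
  rw [hsum]
  split_ifs with h
  · subst h
    rw [Int.abs_eq_natAbs, Int.cast_natCast]
    simp only [one_pow, sum_const, card_range, nsmul_eq_mul, mul_one]
  · rw [geom_sum_eq h]
    have := zpow_abs_eq_one_of_zpow_eq_one hw
    rw [Int.abs_eq_natAbs, zpow_natCast] at this
    rw [this, sub_self, zero_div]

/-- Orthogonality of the characters of `(ℤ/m)^s`. -/
theorem sum_boxE_zpowV_epsPt {s : ℕ} {m : ℤ} (hm : m ≠ 0) (x : ZS s) :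
    ∑ e ∈ boxE s m, zpowV (epsPt m e) x =
      if ∀ i, m ∣ x i then ((|m| : ℤ) : ℂ) ^ s else 0 := by
  simp_rw [fun e => zpowV_epsPt_comm m e x, zpowV, boxE]
  rw [← prod_univ_sum (fun _ => Finset.Ico 0 |m|) (fun i n => epsPt m x i ^ n)]
  have h1 (i : Fin s) : ∑ n ∈ Finset.Ico 0 |m|, epsPt m x i ^ n =
      if m ∣ x i then ((|m| : ℤ) : ℂ) else 0 := by
    rw [sum_Ico_zpow (w := epsPt m x i) (exp_zpow_eq_one hm (x i))]
    simp only [epsPt, exp_eq_one_iff_dvd hm]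
  simp_rw [h1]
  split_ifs with h
  · simp [h]
  · push Not at h
    obtain ⟨i, hi⟩ := h
    exact prod_eq_zero (mem_univ i) (if_neg hi)

theorem inE_eq_zero_of_dvd {s : ℕ} {m : ℤ} {e : ZS s} (he : inE m e) (h : ∀ i, m ∣ e i) :
    e = 0 := by
  funext i
  refine Int.eq_zero_of_abs_lt_dvd (m := |m|) ((abs_dvd _ _).mpr (h i)) ?_
  rw [abs_of_nonneg (he i).1]
  exact (he i).2

/-- Discrete Fourier inversion on `(ℤ/m)^s`: the transform of a finitely supported function is
concentrated at `0` if and only if the sums over all residue classes agree. -/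
theorem sum_zpowV_epsPt_eq_iff {s : ℕ} {m : ℤ} (hm : m ≠ 0) (S : Finset (ZS s)) (f : ZS s → ℂ)
    (c : ℂ) :
    (∀ e, inE m e → ∑ γ ∈ S, f γ * zpowV (epsPt m e) γ =
        if e = 0 then ((|m| : ℤ) : ℂ) ^ s * c else 0) ↔
      ∀ α : ZS s, ∑ γ ∈ S with ∀ i, m ∣ α i - γ i, f γ = c := by
  have hN : ((|m| : ℤ) : ℂ) ^ s ≠ 0 := pow_ne_zero _ (by exact_mod_cast abs_ne_zero.mpr hm)
  have h0 : (0 : ZS s) ∈ boxE s m := mem_boxE.mpr fun i => ⟨le_rfl, abs_pos.mpr hm⟩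
  constructor
  · intro h α
    refine mul_left_cancel₀ hN ?_
    calc ((|m| : ℤ) : ℂ) ^ s * ∑ γ ∈ S with ∀ i, m ∣ α i - γ i, f γ
        = ∑ γ ∈ S, f γ * ∑ e ∈ boxE s m, zpowV (epsPt m e) (γ + -α) := by
          rw [sum_filter, mul_sum]
          refine sum_congr rfl fun γ _ => ?_
          have hiff : (∀ i, m ∣ (γ + -α) i) ↔ ∀ i, m ∣ α i - γ i :=
            forall_congr' fun i => by
              rw [Pi.add_apply, Pi.neg_apply, ← sub_eq_add_neg, dvd_sub_comm]
          rw [sum_boxE_zpowV_epsPt hm]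
          simp only [hiff, mul_ite, mul_zero, mul_comm]
      _ = ∑ e ∈ boxE s m, zpowV (epsPt m e) (-α) * ∑ γ ∈ S, f γ * zpowV (epsPt m e) γ := by
          simp_rw [mul_sum]
          rw [sum_comm]
          refine sum_congr rfl fun e _ => sum_congr rfl fun γ _ => ?_
          rw [zpowV_add (epsPt_ne_zero m e)]
          ring
      _ = ((|m| : ℤ) : ℂ) ^ s * c := by
          rw [sum_eq_single_of_mem 0 h0 fun e he hne => by
            rw [h e (mem_boxE.mp he), if_neg hne, mul_zero]]
          rw [h 0 (mem_boxE.mp h0), if_pos rfl, epsPt_zero]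
          simp [zpowV, onesC]
  · intro h e he
    have hmaps : ∀ γ ∈ S, (fun i => γ i % m) ∈ boxE s m := fun γ _ =>
      mem_boxE.mpr fun i => ⟨Int.emod_nonneg _ hm, Int.emod_lt_abs _ hm⟩
    have hfib (α : ZS s) (hα : α ∈ boxE s m) :
        ∑ γ ∈ S with (fun i => γ i % m) = α, f γ * zpowV (epsPt m e) γ =
          zpowV (epsPt m α) e * c := by
      have hfilter : ({γ ∈ S | (fun i => γ i % m) = α} : Finset (ZS s)) =
          {γ ∈ S | ∀ i, m ∣ α i - γ i} := by
        refine filter_congr fun γ _ => ?_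
        rw [funext_iff]
        refine forall_congr' fun i => ?_
        obtain ⟨hα0, hα1⟩ := mem_boxE.mp hα i
        have hmod : α i % m = α i := by
          rw [← Int.emod_abs, Int.emod_eq_of_lt hα0 hα1]
        conv_lhs => rw [← hmod]
        exact Int.modEq_iff_dvd
      rw [hfilter, ← h α, mul_sum]
      refine sum_congr rfl fun γ hγ => ?_
      rw [← zpowV_epsPt_comm m e α, zpowV_epsPt_eq_of_dvd hm e (mem_filter.mp hγ).2, mul_comm]
    rw [← sum_fiberwise_of_maps_to hmaps, sum_congr rfl hfib, ← sum_mul,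
      sum_boxE_zpowV_epsPt hm, ite_mul, zero_mul]
    refine if_congr ⟨inE_eq_zero_of_dvd he, ?_⟩ rfl rfl
    rintro rfl i
    exact dvd_zero m

theorem symbolD_eq_sum {s : ℕ} {a : ZS s → ℝ} (ha : (Function.support a).Finite)
    (j : Fin s → ℕ) {z : Fin s → ℂ} (hz : ∀ i, z i ≠ 0) :
    symbolD a j z = zpowV z (fun i => -(j i : ℤ)) *
      ∑ γ ∈ ha.toFinset, (a γ * qpolyC j (fun i => (γ i : ℂ))) * zpowV z γ := by
  rw [symbolD, finsum_eq_sum_of_support_subset (s := ha.toFinset), mul_sum]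
  · refine sum_congr rfl fun γ _ => ?_
    have : (fun i => γ i - (j i : ℤ)) = γ + fun i => -(j i : ℤ) := by
      funext i
      simp [sub_eq_add_neg]
    rw [this, zpowV_add hz]
    ring
  · intro γ hγ
    rw [Set.Finite.coe_toFinset]
    intro h0
    exact hγ (by simp [h0])

theorem symbolD_conditions_iff {s : ℕ} {m : ℤ} (hm : m ≠ 0) {a : ZS s → ℝ}
    (ha : (Function.support a).Finite) (j : Fin s → ℕ) (c : ℂ) :
    (symbolD a j onesC = ((|m| : ℤ) : ℂ) ^ s * c ∧
        ∀ e : ZS s, inE m e → e ≠ 0 → symbolD a j (epsPt m e) = 0) ↔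
      ∀ α : ZS s, ∑ γ ∈ ha.toFinset with ∀ i, m ∣ α i - γ i,
        (a γ * qpolyC j (fun i => (γ i : ℂ))) = c := by
  rw [← sum_zpowV_epsPt_eq_iff hm]
  have hone : symbolD a j onesC = ∑ γ ∈ ha.toFinset,
      (a γ * qpolyC j (fun i => (γ i : ℂ))) * zpowV (epsPt m 0) γ := by
    rw [symbolD_eq_sum ha j (by simp [onesC]), epsPt_zero]
    simp [zpowV, onesC]
  have hzero (e : ZS s) : symbolD a j (epsPt m e) = 0 ↔ ∑ γ ∈ ha.toFinset,
      (a γ * qpolyC j (fun i => (γ i : ℂ))) * zpowV (epsPt m e) γ = 0 := by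
    rw [symbolD_eq_sum ha j (epsPt_ne_zero m e), mul_eq_zero,
      or_iff_right (zpowV_ne_zero (epsPt_ne_zero m e) _)]
  rw [hone]
  simp only [hzero]
  constructor
  · rintro ⟨h1, h2⟩ e he
    split_ifs with h
    · rw [h, h1]
    · exact h2 e he h
  · intro h
    refine ⟨?_, fun e he hne => by rw [h e he, if_neg hne]⟩
    rw [h 0 fun i => ⟨le_rfl, abs_pos.mpr hm⟩, if_pos rfl]

theorem finsum_mask_mul_eq_sum {s : ℕ} {m : ℤ} (hm : m ≠ 0) {a : ZS s → ℝ}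
    (ha : (Function.support a).Finite) (α : ZS s) (j : Fin s → ℕ) :
    ∑ᶠ β : ZS s, a (α - m • β) * ∏ i, (β i : ℝ) ^ (j i) =
      ∑ γ ∈ ha.toFinset with ∀ i, m ∣ α i - γ i,
        a γ * ∏ i, (((α i : ℝ) - γ i) / m) ^ (j i) := by
  have hm' : (m : ℝ) ≠ 0 := by exact_mod_cast hm
  have hinj : Function.Injective fun β : ZS s => α - m • β := by
    intro β β' h
    funext i
    have := congrFun h i
    simpa [hm] using this
  have hfun (β : ZS s) : a (α - m • β) * ∏ i, (β i : ℝ) ^ (j i) =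
      (fun γ : ZS s => a γ * ∏ i, (((α i : ℝ) - γ i) / m) ^ (j i)) (α - m • β) := by
    simp [hm']
  rw [finsum_congr hfun,
    ← finsum_mem_range
      (f := fun γ : ZS s => a γ * ∏ i, (((α i : ℝ) - γ i) / m) ^ (j i)) hinj,
    finsum_mem_eq_sum_of_inter_support_eq]
  ext γ
  simp only [Set.mem_inter_iff, Set.mem_range, Function.mem_support, coe_filter,
    Set.Finite.mem_toFinset, Set.mem_ofPred_eq]
  have hiff : (∃ β : ZS s, α - m • β = γ) ↔ ∀ i, m ∣ α i - γ i := by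
    constructor
    · rintro ⟨β, rfl⟩ i
      simp
    · intro h
      choose β hβ using h
      refine ⟨β, ?_⟩
      funext i
      simp [← hβ]
  rw [hiff]
  constructor
  · rintro ⟨h, hne⟩
    exact ⟨⟨left_ne_zero_of_mul hne, h⟩, hne⟩
  · rintro ⟨⟨_, h⟩, hne⟩
    exact ⟨h, hne⟩

/-- The difference between a weighted sum of point evaluations and the evaluation at `τ`. -/
def evalDefect {ι κ K : Type*} [Field K] (S : Finset κ) (w : κ → K) (x : κ → ι → K) (τ : ι → K) :
    ((ι → K) → K) →ₗ[K] K :=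
  ∑ γ ∈ S, w γ • LinearMap.proj (x γ) - LinearMap.proj τ

theorem evalDefect_eq_zero_iff {ι κ K : Type*} [Field K] (S : Finset κ) (w : κ → K)
    (x : κ → ι → K) (τ : ι → K) (f : (ι → K) → K) :
    evalDefect S w x τ f = 0 ↔ ∑ γ ∈ S, w γ * f (x γ) = f τ := by
  simp [evalDefect, sub_eq_zero]

theorem eval_descPochhammer_eq_prod (n : ℕ) (x : ℂ) :
    (descPochhammer ℂ n).eval x = ∏ l ∈ range n, (x - l) := by
  induction n with
  | zero => simp
  | succ n ih => rw [prod_range_succ, ← ih, descPochhammer_succ_eval]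

open Polynomial in
theorem degree_reflected_pow {m α : ℂ} (hm : m ≠ 0) (n : ℕ) :
    ((C (-m⁻¹) * X + C (α / m)) ^ n).degree = (n : WithBot ℕ) := by
  rw [degree_pow, degree_linear (neg_ne_zero.mpr (inv_ne_zero hm))]
  simp

/-- For `τ ∈ ℝ^s`, the conditions `(D^j a)(1,…,1) = |m|^s q_j(τ)` and
`(D^j a)(ε) = 0` for all `ε ∈ Ξ'`, for all `|j| ≤ k`, hold if and only if
`∑_β a_{α-mβ} β^j = ((α-τ)/m)^j` for all `α ∈ ℤ^s` and `|j| ≤ k`. -/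
theorem stmt7 {s : ℕ} (hs : 1 ≤ s) (m : ℤ) (hm : 2 ≤ |m|)
    (a : ZS s → ℝ) (ha : (Function.support a).Finite) (k : ℕ) (hk : 1 ≤ k) (τ : Fin s → ℝ) :
    (∀ j : Fin s → ℕ, (∑ i, j i) ≤ k →
        symbolD a j onesC = ((|m| : ℤ) : ℂ) ^ s * qpolyC j (fun i => (τ i : ℂ)) ∧
        ∀ e : ZS s, inE m e → e ≠ 0 → symbolD a j (epsPt m e) = 0) ↔
      (∀ α : ZS s, ∀ j : Fin s → ℕ, (∑ i, j i) ≤ k →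
        (∑ᶠ β : ZS s, a (α - m • β) * ∏ i, (β i : ℝ) ^ (j i))
          = ∏ i, (((α i : ℝ) - τ i) / (m : ℝ)) ^ (j i)) := by
  have hm0 : m ≠ 0 := by
    rintro rfl
    simp at hm
  have hmC : (m : ℂ) ≠ 0 := by exact_mod_cast hm0
  let L (α : ZS s) : ((Fin s → ℂ) → ℂ) →ₗ[ℂ] ℂ :=
    evalDefect {γ ∈ ha.toFinset | ∀ i, m ∣ α i - γ i} (fun γ => (a γ : ℂ))
      (fun γ i => (γ i : ℂ)) (fun i => (τ i : ℂ))
  let p (_ : Fin s) (n : ℕ) : Polynomial ℂ := descPochhammer ℂ n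
  let r (α : ZS s) (i : Fin s) (n : ℕ) : Polynomial ℂ :=
    (Polynomial.C (-(m : ℂ)⁻¹) * Polynomial.X + Polynomial.C ((α i : ℂ) / m)) ^ n
  have hp (i : Fin s) (n : ℕ) : (p i n).degree = n := by
    rw [Polynomial.degree_eq_natDegree (monic_descPochhammer ℂ n).ne_zero,
      descPochhammer_natDegree]
  have hr (α : ZS s) (i : Fin s) (n : ℕ) : (r α i n).degree = n := degree_reflected_pow hmC n
  have hsymbol (j : Fin s → ℕ) :
      (symbolD a j onesC = ((|m| : ℤ) : ℂ) ^ s * qpolyC j (fun i => (τ i : ℂ)) ∧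
        ∀ e : ZS s, inE m e → e ≠ 0 → symbolD a j (epsPt m e) = 0) ↔
      ∀ α, L α (fun x => ∏ i, (p i (j i)).eval (x i)) = 0 := by
    rw [symbolD_conditions_iff hm0 ha]
    refine forall_congr' fun α => ?_
    simp only [L, evalDefect_eq_zero_iff, p, eval_descPochhammer_eq_prod, qpolyC]
  have hmoment (α : ZS s) (j : Fin s → ℕ) :
      (∑ᶠ β : ZS s, a (α - m • β) * ∏ i, (β i : ℝ) ^ (j i)
          = ∏ i, (((α i : ℝ) - τ i) / (m : ℝ)) ^ (j i)) ↔
      L α (fun x => ∏ i, (r α i (j i)).eval (x i)) = 0 := by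
    have heval (i : Fin s) (n : ℕ) (x : ℂ) :
        (r α i n).eval x = (((α i : ℂ) - x) / m) ^ n := by
      simp only [r, Polynomial.eval_pow, Polynomial.eval_add, Polynomial.eval_mul,
        Polynomial.eval_C, Polynomial.eval_X]
      congr 1
      ring
    rw [finsum_mask_mul_eq_sum hm0 ha, ← Complex.ofReal_inj]
    simp only [L, evalDefect_eq_zero_iff, heval]
    push_cast
    rfl
  simp only [hsymbol, hmoment]
  constructor
  · intro h α
    exact map_prod_eval_eq_zero_of_degree_eq (L α) p (r α) hp (hr α) k fun j hj => h j hj α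
  · intro h j hj α
    exact map_prod_eval_eq_zero_of_degree_eq (L α) (r α) p (hr α) hp k (h α) j hj

end
end

section
/- Let Θ = (θ^1,…,θ^n) be an s × n integer matrix of rank s with n ≥ s, and let a_Θ be the mask (with dilation 2I) whose symbol is a_Θ(z) = 2^s Π_{k=1}^n (1+z^{θ^k})/2. If the subdivision scheme S_{a_Θ} is convergent, then it reproduces linear polynomials (all polynomials of total degree ≤ 1) when its parameter values are t^{(r)}_α = α/2^r − τ Σ_{i=1}^r 2^{−i} with τ = (1/2)(Σ_{k=1}^n θ^k_1, …, Σ_{k=1}^n θ^k_s). -/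
open Finset Filter

noncomputable section

/-- The translation operator `(T_θ d)_α = d_{α-θ}`. -/
def translation {s : ℕ} (θ : ZS s) : Module.End ℝ (ZS s → ℝ) :=
  LinearMap.funLeft ℝ ℝ (fun α => α - θ)

@[simp] lemma translation_apply {s : ℕ} (θ : ZS s) (d : ZS s → ℝ) (α : ZS s) :
    translation θ d α = d (α - θ) := rfl

/-- Convolution of sequences with finitely supported masks. -/
def maskConv {s : ℕ} : AddMonoidAlgebra ℝ (ZS s) →ₐ[ℝ] Module.End ℝ (ZS s → ℝ) :=
  AddMonoidAlgebra.lift ℝ _ _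
    { toFun := fun θ => translation θ.toAdd
      map_one' := by ext d α; simp
      map_mul' := fun x y => by ext d α; simp [sub_sub] }

lemma maskConv_single {s : ℕ} (θ : ZS s) (c : ℝ) :
    maskConv (AddMonoidAlgebra.single θ c) = c • translation θ := by
  simp [maskConv]

lemma maskConv_apply {s : ℕ} (P : AddMonoidAlgebra ℝ (ZS s)) (d : ZS s → ℝ) (α : ZS s) :
    maskConv P d α = ∑ γ ∈ P.coeff.support, P.coeff γ * d (α - γ) := by
  simp [maskConv, AddMonoidAlgebra.lift_apply, Finsupp.sum, LinearMap.sum_apply]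

lemma two_smul_injective {s : ℕ} : Function.Injective (fun β : ZS s => (2 : ℤ) • β) :=
  smul_right_injective _ two_ne_zero

/-- Upsampling: `(U d)_{2β} = d_β` and `(U d)_α = 0` if `α ∉ 2ℤ^s`. -/
def upsample {s : ℕ} : Module.End ℝ (ZS s → ℝ) :=
  Function.ExtendByZero.linearMap ℝ (fun β : ZS s => (2 : ℤ) • β)

lemma upsample_two_smul {s : ℕ} (d : ZS s → ℝ) (β : ZS s) :
    upsample d ((2 : ℤ) • β) = d β :=
  two_smul_injective.extend_apply _ _ _

lemma upsample_of_notMem {s : ℕ} (d : ZS s → ℝ) {α : ZS s}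
    (h : ¬ ∃ β : ZS s, (2 : ℤ) • β = α) : upsample d α = 0 :=
  Function.extend_apply' _ _ _ h

/-- The subdivision operator of a mask as a linear map. -/
def subdivision {s : ℕ} (P : AddMonoidAlgebra ℝ (ZS s)) : Module.End ℝ (ZS s → ℝ) :=
  maskConv P * upsample

lemma subdOp_eq_subdivision {s : ℕ} (P : AddMonoidAlgebra ℝ (ZS s)) :
    subdOp 2 (fun α => P.coeff α) = subdivision P := by
  funext d α
  set G : ZS s → ℝ := fun x => P.coeff (α - x) * upsample d x with hG
  calc ∑ᶠ β : ZS s, P.coeff (α - (2 : ℤ) • β) * d β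
      = ∑ᶠ β : ZS s, G ((2 : ℤ) • β) := by simp only [hG, upsample_two_smul]
    _ = ∑ᶠ x ∈ Set.range (fun β : ZS s => (2 : ℤ) • β), G x :=
        (finsum_mem_range two_smul_injective).symm
    _ = ∑ᶠ x, G x := by
        refine finsum_congr fun x => ?_
        classical
        rw [finsum_eq_if]
        split_ifs with h
        · rfl
        · simp only [hG, upsample_of_notMem d h, mul_zero]
    _ = ∑ᶠ γ, G (α - γ) := (finsum_comp_equiv (Equiv.subLeft α)).symm
    _ = subdivision P d α := by
        simp only [subdivision, Module.End.mul_apply, maskConv_apply, hG, sub_sub_cancel]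
        refine finsum_eq_sum_of_support_subset _ fun γ hγ => ?_
        simp only [Function.mem_support, ne_eq, mul_eq_zero, not_or] at hγ
        simpa using hγ.1

lemma upsample_translation {s : ℕ} (θ : ZS s) :
    upsample * translation θ = translation ((2 : ℤ) • θ) * upsample := by
  ext d α
  simp only [Module.End.mul_apply, translation_apply]
  by_cases h : ∃ β : ZS s, (2 : ℤ) • β = α
  · obtain ⟨β, rfl⟩ := h
    rw [← smul_sub, upsample_two_smul, upsample_two_smul, translation_apply]
  · rw [upsample_of_notMem _ h, upsample_of_notMem]
    rintro ⟨β, hβ⟩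
    exact h ⟨β + θ, by rw [smul_add, hβ, sub_add_cancel]⟩

lemma commute_translation_maskConv {s : ℕ} (θ : ZS s) (P : AddMonoidAlgebra ℝ (ZS s)) :
    translation θ * maskConv P = maskConv P * translation θ := by
  have h : translation θ = maskConv (AddMonoidAlgebra.single θ 1) := by
    rw [maskConv_single, one_smul]
  rw [h, ← map_mul, ← map_mul, mul_comm]

lemma subdivision_translation {s : ℕ} (P : AddMonoidAlgebra ℝ (ZS s)) (θ : ZS s) :
    subdivision P * translation θ = translation ((2 : ℤ) • θ) * subdivision P := by
  rw [subdivision, mul_assoc, upsample_translation, ← mul_assoc, ← mul_assoc,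
    commute_translation_maskConv]

lemma subdivision_pow_translation {s : ℕ} (P : AddMonoidAlgebra ℝ (ZS s)) (m : ℕ) (θ : ZS s) :
    subdivision P ^ m * translation θ = translation ((2 : ℤ) ^ m • θ) * subdivision P ^ m := by
  induction m generalizing θ with
  | zero => simp
  | succ m ih =>
    rw [pow_succ, mul_assoc, subdivision_translation, ← mul_assoc, ih, mul_assoc, smul_smul,
      ← pow_succ]

/-- Evaluation of the symbol of a mask at `z ∈ (ℂ∖{0})^s`. -/
def symbolEval {s : ℕ} (z : Fin s → ℂˣ) : AddMonoidAlgebra ℝ (ZS s) →ₐ[ℝ] ℂ :=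
  AddMonoidAlgebra.lift ℝ _ _
    { toFun := fun α => zpowV (fun i => (z i : ℂ)) α.toAdd
      map_one' := by simp [zpowV]
      map_mul' := fun x y => by
        simp [zpowV, zpow_add₀, Finset.prod_mul_distrib] }

lemma symbolEval_single {s : ℕ} (z : Fin s → ℂˣ) (θ : ZS s) (c : ℝ) :
    symbolEval z (AddMonoidAlgebra.single θ c) = c * zpowV (fun i => (z i : ℂ)) θ := by
  simp [symbolEval]

lemma symbolEval_apply {s : ℕ} (z : Fin s → ℂˣ) (P : AddMonoidAlgebra ℝ (ZS s)) :
    symbolEval z P = ∑ α ∈ P.coeff.support, (P.coeff α : ℂ) * zpowV (fun i => (z i : ℂ)) α := by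
  simp [symbolEval, AddMonoidAlgebra.lift_apply, Finsupp.sum]

/-- The monomial `z ↦ z^α` as a character of `(ℂ∖{0})^s`. -/
def monomialChar {s : ℕ} (α : ZS s) : (Fin s → ℂˣ) →* ℂ where
  toFun z := zpowV (fun i => (z i : ℂ)) α
  map_one' := by simp [zpowV]
  map_mul' x y := by simp [zpowV, mul_zpow, Finset.prod_mul_distrib]

lemma monomialChar_injective {s : ℕ} : Function.Injective (monomialChar (s := s)) := by
  intro α β h
  funext i
  have h2 := DFunLike.congr_fun h
    (Function.update (1 : Fin s → ℂˣ) i (Units.mk0 2 two_ne_zero))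
  have key : ∀ γ : ZS s, monomialChar γ
      (Function.update (1 : Fin s → ℂˣ) i (Units.mk0 2 two_ne_zero)) = (2 : ℂ) ^ γ i := by
    intro γ
    simp only [monomialChar, MonoidHom.coe_mk, OneHom.coe_mk, zpowV]
    rw [Finset.prod_eq_single i]
    · simp
    · intro j _ hj
      simp [Function.update_of_ne hj]
    · simp
  rw [key, key] at h2
  have h3 : (2 : ℝ) ^ α i = (2 : ℝ) ^ β i :=
    Complex.ofReal_injective (by push_cast; exact h2)
  exact zpow_right_injective₀ two_pos (by norm_num) h3

lemma symbolEval_injective {s : ℕ} {P Q : AddMonoidAlgebra ℝ (ZS s)}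
    (h : ∀ z, symbolEval z P = symbolEval z Q) : P = Q := by
  rw [← sub_eq_zero]
  set D := P - Q with hD
  have hz : ∀ z, symbolEval z D = 0 := fun z => by rw [hD, map_sub, h z, sub_self]
  have hli := (linearIndependent_monoidHom (Fin s → ℂˣ) ℂ).comp _
    (monomialChar_injective (s := s))
  rw [linearIndependent_iff'] at hli
  have h0 := hli D.coeff.support (fun α => (D.coeff α : ℂ)) (by
    funext z
    have := hz z
    rw [symbolEval_apply] at this
    simpa [Finset.sum_apply, monomialChar] using this)
  have hc : D.coeff = 0 := by
    ext α
    by_cases hα : α ∈ D.coeff.support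
    · simpa using h0 α hα
    · simpa using hα
  rw [← AddMonoidAlgebra.ofCoeff_coeff D, hc]
  rfl

/-- The mask with symbol `2^s ∏_{k ∈ K} (1 + z^{θ^k})/2`. -/
def boxMask {s n : ℕ} (θ : Fin n → ZS s) (K : Finset (Fin n)) : AddMonoidAlgebra ℝ (ZS s) :=
  (2 ^ s : ℝ) • ∏ k ∈ K, (1 / 2 : ℝ) • (1 + AddMonoidAlgebra.single (θ k) 1)

lemma boxMask_insert {s n : ℕ} (θ : Fin n → ZS s) {K : Finset (Fin n)} {k : Fin n}
    (hk : k ∉ K) : boxMask θ (insert k K) =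
      (1 / 2 : ℝ) • ((1 + AddMonoidAlgebra.single (θ k) 1) * boxMask θ K) := by
  rw [boxMask, boxMask, Finset.prod_insert hk, smul_mul_assoc, mul_smul_comm, smul_comm]

lemma eq_coeff_boxMask {s n : ℕ} (θ : Fin n → ZS s) (a : ZS s → ℝ)
    (ha : (Function.support a).Finite)
    (hsymb : ∀ z : Fin s → ℂ, (∀ i, z i ≠ 0) →
      symbolD a 0 z = 2 ^ s * ∏ k, (1 + zpowV z (θ k)) / 2) :
    a = fun α => (boxMask θ univ).coeff α := by
  let P : AddMonoidAlgebra ℝ (ZS s) := AddMonoidAlgebra.ofCoeff (Finsupp.ofSupportFinite a ha)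
  suffices h : P = boxMask θ univ by
    rw [← h]
    rfl
  refine symbolEval_injective fun z => ?_
  have h1 : symbolEval z P = symbolD a 0 (fun i => (z i : ℂ)) := by
    rw [symbolEval_apply, symbolD, finsum_eq_sum_of_support_subset (s := P.coeff.support)]
    · refine Finset.sum_congr rfl fun α _ => ?_
      simp [qpolyC, P, Finsupp.ofSupportFinite_coe]
    · intro α hα
      simp only [Function.mem_support, ne_eq, mul_eq_zero, not_or] at hα
      have : a α ≠ 0 := by exact_mod_cast hα.1.2
      simpa [P, Finsupp.ofSupportFinite] using this
  rw [h1, hsymb _ fun i => (z i).ne_zero, boxMask, map_smul, map_prod, Complex.real_smul]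
  push_cast
  congr 1
  refine Finset.prod_congr rfl fun k _ => ?_
  rw [map_smul, map_add, map_one, symbolEval_single, Complex.real_smul]
  push_cast
  ring

lemma subdivision_boxMask_insert {s n : ℕ} (θ : Fin n → ZS s) {K : Finset (Fin n)} {k : Fin n}
    (hk : k ∉ K) : subdivision (boxMask θ (insert k K)) =
      (1 / 2 : ℝ) • ((1 + translation (θ k)) * subdivision (boxMask θ K)) := by
  simp [subdivision, boxMask_insert θ hk, maskConv_single, mul_assoc]

/-- Backward differences commute with box subdivision up to removing a direction. -/
lemma sub_translation_mul_subdivision_insert {s n : ℕ} (θ : Fin n → ZS s)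
    {K : Finset (Fin n)} {k : Fin n} (hk : k ∉ K) :
    (1 - translation (θ k)) * subdivision (boxMask θ (insert k K)) =
      (1 / 2 : ℝ) • (subdivision (boxMask θ K) * (1 - translation (θ k))) := by
  have h2 : translation (θ k) * translation (θ k) = translation ((2 : ℤ) • θ k) := by
    ext d α
    simp [sub_sub, two_smul]
  rw [subdivision_boxMask_insert θ hk, mul_smul_comm, ← mul_assoc, mul_sub, mul_one,
    subdivision_translation, ← h2]
  congr 1
  simp only [sub_mul, add_mul, mul_add, one_mul, mul_one, mul_assoc]
  abel

lemma param_two {s : ℕ} (τ : Fin s → ℝ) (r : ℕ) (α : ZS s) (i : Fin s) :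
    param 2 τ r α i = (α i + τ i) / 2 ^ r - τ i := by
  have h : ∀ r : ℕ, ∑ n ∈ Finset.range r, ((2 : ℝ) ^ (n + 1))⁻¹ = 1 - ((2 : ℝ) ^ r)⁻¹ := by
    intro r
    induction r with
    | zero => simp
    | succ r ih =>
      rw [Finset.sum_range_succ, ih, pow_succ]
      field_simp
      ring
  simp only [param, Int.cast_ofNat, h]
  field_simp
  ring

/-- The lattice points `α_m`, scaled by `2^{-m}`, tend to `y`. -/
def ScaledTendsto {s : ℕ} (α : ℕ → ZS s) (y : Fin s → ℝ) : Prop :=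
  ∀ i, Tendsto (fun m => (α m i : ℝ) / 2 ^ m) atTop (nhds (y i))

lemma tendsto_const_div_two_pow (c : ℝ) :
    Tendsto (fun m : ℕ => c / 2 ^ m) atTop (nhds 0) :=
  tendsto_const_nhds.div_atTop (tendsto_pow_atTop_atTop_of_one_lt one_lt_two)

lemma tendsto_floor_two_pow (y : ℝ) :
    Tendsto (fun m : ℕ => (⌊2 ^ m * y⌋ : ℝ) / 2 ^ m) atTop (nhds y) := by
  have h := tendsto_const_div_two_pow 1
  have h2 : Tendsto (fun m : ℕ => y - 1 / 2 ^ m) atTop (nhds y) := by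
    simpa using tendsto_const_nhds.sub h
  refine tendsto_of_tendsto_of_tendsto_of_le_of_le h2 tendsto_const_nhds
    (fun m => ?_) fun m => ?_
  · have h3 : (0 : ℝ) < 2 ^ m := by positivity
    have h4 := Int.sub_one_lt_floor ((2 : ℝ) ^ m * y)
    dsimp only
    rw [le_div_iff₀ h3, sub_mul, one_div, inv_mul_cancel₀ h3.ne']
    linarith
  · have h3 : (0 : ℝ) < 2 ^ m := by positivity
    have h4 := Int.floor_le ((2 : ℝ) ^ m * y)
    dsimp only
    rw [div_le_iff₀ h3]
    linarith

lemma scaledTendsto_floor {s : ℕ} (y : Fin s → ℝ) :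
    ScaledTendsto (fun m i => ⌊2 ^ m * y i⌋) y :=
  fun i => tendsto_floor_two_pow (y i)

lemma ScaledTendsto.add {s : ℕ} {α β : ℕ → ZS s} {y v : Fin s → ℝ}
    (hα : ScaledTendsto α y) (hβ : ScaledTendsto β v) :
    ScaledTendsto (fun m => α m + β m) (y + v) := fun i => by
  simpa [add_div] using (hα i).add (hβ i)

lemma scaledTendsto_const {s : ℕ} (β : ZS s) : ScaledTendsto (fun _ => β) 0 :=
  fun i => tendsto_const_div_two_pow (β i)

lemma scaledTendsto_smul {s : ℕ} {c : ℕ → ℤ} {x : ℝ}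
    (hc : Tendsto (fun m => (c m : ℝ) / 2 ^ m) atTop (nhds x)) (θ : ZS s) :
    ScaledTendsto (fun m => c m • θ) (fun i => x * θ i) := fun i => by
  simpa [mul_div_right_comm] using hc.mul_const (θ i : ℝ)

/-- The subdivision iterates of `d` for the mask `P` tend to `ψ` along scaled lattice points. -/
def IteratesTendTo {s : ℕ} (P : AddMonoidAlgebra ℝ (ZS s)) (d : ZS s → ℝ)
    (ψ : (Fin s → ℝ) → ℝ) : Prop :=
  ∀ (α : ℕ → ZS s) (y : Fin s → ℝ), ScaledTendsto α y →
    Tendsto (fun m => (subdivision P ^ m) d (α m)) atTop (nhds (ψ y))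

lemma ConvergesTo.iteratesTendTo {s : ℕ} {P : AddMonoidAlgebra ℝ (ZS s)} {τ : Fin s → ℝ}
    {d : ZS s → ℝ} {g : (Fin s → ℝ) → ℝ}
    (h : ConvergesTo 2 (fun α => P.coeff α) τ d g) :
    IteratesTendTo P d (fun y => g (y - τ)) := by
  intro α y hα
  obtain ⟨F, hF, hFd, hFg⟩ := h
  have hg : Continuous g := hFg.continuous (Frequently.of_forall hF)
  have ht : Tendsto (fun m => param 2 τ m (α m)) atTop (nhds (y - τ)) := by
    rw [tendsto_pi_nhds]
    intro i
    simp only [param_two, add_div]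
    simpa using ((hα i).add (tendsto_const_div_two_pow (τ i))).sub_const (τ i)
  refine (hFg.tendsto_comp hg.continuousAt ht).congr fun m => ?_
  rw [hFd, subdOp_eq_subdivision, Module.End.pow_apply]

lemma ConvergesTo.uniform_of_eq_zero {s : ℕ} {P : AddMonoidAlgebra ℝ (ZS s)} {τ : Fin s → ℝ}
    {d : ZS s → ℝ} {g : (Fin s → ℝ) → ℝ}
    (h : ConvergesTo 2 (fun α => P.coeff α) τ d g) (hg : ∀ y, g y = 0) {ε : ℝ} (hε : 0 < ε) :
    ∀ᶠ m in atTop, ∀ α, |(subdivision P ^ m) d α| < ε := by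
  obtain ⟨F, hF, hFd, hFg⟩ := h
  filter_upwards [Metric.tendstoUniformly_iff.1 hFg ε hε] with m hm α
  have := hm (param 2 τ m α)
  rwa [hFd, hg, subdOp_eq_subdivision, ← Module.End.pow_apply, dist_zero_left,
    Real.norm_eq_abs] at this

lemma subdivision_apply_eq_zero {s : ℕ} {P : AddMonoidAlgebra ℝ (ZS s)} {d : ZS s → ℝ}
    {α : ZS s} (h : ∀ γ β, P.coeff γ ≠ 0 → d β ≠ 0 → α ≠ γ + (2 : ℤ) • β) :
    subdivision P d α = 0 := by
  rw [subdivision, Module.End.mul_apply, maskConv_apply]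
  refine Finset.sum_eq_zero fun γ hγ => ?_
  by_cases hβ : ∃ β : ZS s, (2 : ℤ) • β = α - γ
  · obtain ⟨β, hβ⟩ := hβ
    rw [← hβ, upsample_two_smul]
    by_cases hd : d β = 0
    · rw [hd, mul_zero]
    · exact absurd (by rw [hβ, add_sub_cancel]) (h γ β (by simpa using hγ) hd)
  · rw [upsample_of_notMem _ hβ, mul_zero]

lemma abs_le_of_subdivision_pow_ne_zero {s : ℕ} {P : AddMonoidAlgebra ℝ (ZS s)} {C : ℤ}
    (hC : ∀ γ, P.coeff γ ≠ 0 → ∀ i, |γ i| ≤ C) (m : ℕ) (α : ZS s)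
    (h : (subdivision P ^ m) (Pi.single 0 1) α ≠ 0) (i : Fin s) : |α i| ≤ C * (2 ^ m - 1) := by
  induction m generalizing α with
  | zero =>
    have : α = 0 := by
      by_contra hα
      simp [hα] at h
    simp [this]
  | succ m ih =>
    rw [pow_succ', Module.End.mul_apply] at h
    by_contra! hlt
    refine h (subdivision_apply_eq_zero fun γ β hγ hβ hα => ?_)
    have h1 := hC γ hγ i
    have h2 := ih β hβ
    have h3 : α i = γ i + 2 * β i := by rw [hα]; simp
    rw [h3, pow_succ] at hlt
    have h4 := abs_add_le (γ i) (2 * β i)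
    rw [abs_mul, abs_two] at h4
    linarith

lemma finsum_subdivision {s : ℕ} (P : AddMonoidAlgebra ℝ (ZS s)) {d : ZS s → ℝ}
    (hd : (Function.support d).Finite) :
    ∑ᶠ α, subdivision P d α = (∑ γ ∈ P.coeff.support, P.coeff γ) * ∑ᶠ α, d α := by
  have hU : (Function.support (upsample d)).Finite := by
    refine (hd.image fun β => (2 : ℤ) • β).subset fun x hx => ?_
    by_cases h : ∃ β : ZS s, (2 : ℤ) • β = x
    · obtain ⟨β, rfl⟩ := h
      rw [Function.mem_support, upsample_two_smul] at hx
      exact ⟨β, hx, rfl⟩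
    · exact absurd (upsample_of_notMem d h) hx
  have hsum : ∑ᶠ α, upsample d α = ∑ᶠ α, d α := by
    classical
    calc ∑ᶠ x, upsample d x
        = ∑ᶠ x ∈ Set.range (fun β : ZS s => (2 : ℤ) • β), upsample d x := by
          refine finsum_congr fun x => ?_
          rw [finsum_eq_if]
          split_ifs with h
          · rfl
          · exact upsample_of_notMem d h
      _ = ∑ᶠ β, d β := by
          rw [finsum_mem_range two_smul_injective]
          simp only [upsample_two_smul]
  have hshift : ∀ γ : ZS s, (Function.support fun α => upsample d (α - γ)).Finite := fun γ =>
    hU.preimage (sub_left_injective.injOn (s := _))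
  simp only [subdivision, Module.End.mul_apply, maskConv_apply]
  rw [finsum_sum_comm, Finset.sum_mul]
  · refine Finset.sum_congr rfl fun γ _ => ?_
    rw [← mul_finsum, ← hsum]
    congr 1
    exact finsum_comp_equiv (Equiv.subRight γ)
  · intro γ _
    refine (hshift γ).subset fun α hα => ?_
    simp only [Function.mem_support, ne_eq, mul_eq_zero, not_or] at hα
    exact hα.2

lemma sum_coeff_boxMask {s n : ℕ} (θ : Fin n → ZS s) (K : Finset (Fin n)) :
    ∑ γ ∈ (boxMask θ K).coeff.support, (boxMask θ K).coeff γ = 2 ^ s := by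
  have h1 : ∀ θ : ZS s, zpowV (fun _ => ((1 : ℂˣ) : ℂ)) θ = 1 := fun θ => by simp [zpowV]
  have h2 : symbolEval (fun _ => 1) (boxMask θ K) = 2 ^ s := by
    rw [boxMask, map_smul, map_prod]
    simp only [map_smul, map_add, map_one, symbolEval_single, h1]
    norm_num
  rw [symbolEval_apply] at h2
  simp only [h1, mul_one] at h2
  exact_mod_cast h2

lemma exists_ne_zero_of_convergesTo_delta {s : ℕ} {P : AddMonoidAlgebra ℝ (ZS s)}
    (hP : ∑ γ ∈ P.coeff.support, P.coeff γ = 2 ^ s) {τ : Fin s → ℝ} {g : (Fin s → ℝ) → ℝ}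
    (h : ConvergesTo 2 (fun α => P.coeff α) τ (Pi.single 0 1) g) : ∃ y, g y ≠ 0 := by
  by_contra! hg
  obtain ⟨C, hC0, hC⟩ : ∃ C : ℤ, 0 ≤ C ∧ ∀ γ, P.coeff γ ≠ 0 → ∀ i, |γ i| ≤ C := by
    refine ⟨∑ γ ∈ P.coeff.support, ∑ i, |γ i|,
      Finset.sum_nonneg fun γ _ => Finset.sum_nonneg fun i _ => abs_nonneg _, fun γ hγ i => ?_⟩
    refine (Finset.single_le_sum (f := fun i => |γ i|) (fun i _ => abs_nonneg _)
      (Finset.mem_univ i)).trans ?_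
    exact Finset.single_le_sum (f := fun γ : ZS s => ∑ i, |γ i|)
      (fun γ _ => Finset.sum_nonneg fun i _ => abs_nonneg _) (Finsupp.mem_support_iff.2 hγ)
  let B : ℕ → Finset (ZS s) := fun m =>
    Fintype.piFinset fun _ => Finset.Icc (-(C * 2 ^ m)) (C * 2 ^ m)
  have hB : ∀ m, Function.support ((subdivision P ^ m) (Pi.single 0 1)) ⊆ B m := by
    intro m α hα
    simp only [B, Finset.mem_coe, Fintype.mem_piFinset, Finset.mem_Icc, ← abs_le]
    intro i
    have := abs_le_of_subdivision_pow_ne_zero hC m α hα i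
    linarith
  have hsum : ∀ m, ∑ᶠ α, (subdivision P ^ m) (Pi.single 0 1) α = ((2 : ℝ) ^ m) ^ s := by
    intro m
    induction m with
    | zero =>
      rw [pow_zero, Module.End.one_apply, finsum_eq_single _ 0 fun x hx => by simp [hx]]
      simp
    | succ m ih =>
      simp only [pow_succ' (subdivision P), Module.End.mul_apply]
      rw [finsum_subdivision P ((B m).finite_toSet.subset (hB m)), ih, hP, ← mul_pow, pow_succ']
  have hcard : ∀ m, ((B m).card : ℝ) ≤ ((2 * C + 1) * 2 ^ m) ^ s := by
    intro m
    have h1 : (0 : ℤ) ≤ C * 2 ^ m + 1 - -(C * 2 ^ m) := by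
      have : 0 ≤ C * 2 ^ m := by positivity
      linarith
    have h2 : (((C * 2 ^ m + 1 - -(C * 2 ^ m)).toNat : ℕ) : ℝ) = 2 * C * 2 ^ m + 1 := by
      rw [← Int.cast_natCast, Int.toNat_of_nonneg h1]
      push_cast
      ring
    simp only [B, Fintype.card_piFinset, Int.card_Icc, Finset.prod_const, Finset.card_univ,
      Fintype.card_fin, Nat.cast_pow, h2]
    have h3 : (1 : ℝ) ≤ 2 ^ m := one_le_pow₀ one_le_two
    have h4 : (0 : ℝ) ≤ C := by exact_mod_cast hC0
    refine pow_le_pow_left₀ (by positivity) ?_ s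
    linarith
  have hCpos : (0 : ℝ) < 2 * C + 1 := by
    have : (0 : ℝ) ≤ C := by exact_mod_cast hC0
    linarith
  obtain ⟨m, hm⟩ := (h.uniform_of_eq_zero hg
    (show (0 : ℝ) < 1 / (2 * (2 * C + 1) ^ s) by positivity)).exists
  have h5 : ((2 : ℝ) ^ m) ^ s ≤ (B m).card * (1 / (2 * (2 * C + 1) ^ s)) := by
    rw [← hsum m, finsum_eq_sum_of_support_subset _ (hB m), ← nsmul_eq_mul]
    exact Finset.sum_le_card_nsmul _ _ _ fun α _ => (le_abs_self _).trans (hm α).le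
  have h6 := h5.trans (mul_le_mul_of_nonneg_right (hcard m) (by positivity))
  have h7 : ((2 * C + 1) * (2 : ℝ) ^ m) ^ s * (1 / (2 * (2 * C + 1) ^ s)) =
      ((2 : ℝ) ^ m) ^ s / 2 := by
    rw [mul_pow]
    field_simp
  have h8 : (0 : ℝ) < ((2 : ℝ) ^ m) ^ s := by positivity
  linarith

/-- Convergence with a nonzero limit forces the sum rule. -/
lemma subdivision_one_of_iteratesTendTo {s : ℕ} {P : AddMonoidAlgebra ℝ (ZS s)}
    {d : ZS s → ℝ} {ψ : (Fin s → ℝ) → ℝ} (h : IteratesTendTo P d ψ) {y : Fin s → ℝ}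
    (hy : ψ y ≠ 0) : subdivision P 1 = 1 := by
  funext α₀
  set α : ℕ → ZS s := fun m i => ⌊2 ^ m * y i⌋ with hα
  set f : ℕ → ZS s → ℝ := fun m => (subdivision P ^ m) d with hf
  have h1 : Tendsto (fun m => subdivision P (f m) ((2 : ℤ) • α m + α₀)) atTop (nhds (ψ y)) := by
    let β : ℕ → ZS s := fun m => (2 : ℤ) • α (m - 1) + α₀
    have hβ : ScaledTendsto β y := by
      intro i
      rw [← tendsto_add_atTop_iff_nat 1]
      have h2 := (scaledTendsto_floor y i).add
        ((tendsto_add_atTop_iff_nat 1).2 (tendsto_const_div_two_pow (α₀ i)))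
      rw [add_zero] at h2
      refine h2.congr fun m => ?_
      simp only [β, hα, Nat.add_sub_cancel, Pi.add_apply, Pi.smul_apply, smul_eq_mul, pow_succ]
      push_cast
      field_simp
    refine ((tendsto_add_atTop_iff_nat 1).2 (h β y hβ)).congr fun m => ?_
    simp only [β, hf, Nat.add_sub_cancel, pow_succ', Module.End.mul_apply]
  have h2 : Tendsto (fun m => subdivision P (f m) ((2 : ℤ) • α m + α₀)) atTop
      (nhds (subdivision P (ψ y • 1) α₀)) := by
    simp only [subdivision, Module.End.mul_apply, maskConv_apply]
    refine tendsto_finsetSum _ fun γ _ => Tendsto.const_mul _ ?_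
    by_cases hβ : ∃ β : ZS s, (2 : ℤ) • β = α₀ - γ
    · obtain ⟨β, hβ⟩ := hβ
      simp only [add_sub_assoc, ← hβ, ← smul_add, upsample_two_smul]
      have := h _ _ ((scaledTendsto_floor y).add (scaledTendsto_const β))
      simpa using this
    · rw [upsample_of_notMem _ hβ]
      refine tendsto_const_nhds.congr fun m => (upsample_of_notMem _ ?_).symm
      rintro ⟨β, hβ'⟩
      exact hβ ⟨β - α m, by rw [smul_sub, hβ']; abel⟩
  have h3 := tendsto_nhds_unique h1 h2
  rw [map_smul, Pi.smul_apply, smul_eq_mul] at h3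
  exact mul_left_cancel₀ hy (by rw [← h3]; simp)

lemma subdivision_boxMask_support {s n : ℕ} (θ : Fin n → ZS s) (L : ZS s →+ ℝ)
    {K : Finset (Fin n)} (hK : ∀ l ∈ K, L (θ l) = 0) {c : ZS s → ℝ}
    (hc : ∀ α, c α ≠ 0 → L α = 0) (α : ZS s) (hα : subdivision (boxMask θ K) c α ≠ 0) :
    L α = 0 := by
  induction K using Finset.induction_on generalizing α with
  | empty =>
    simp only [subdivision, boxMask, Finset.prod_empty, map_smul, map_one, Module.End.mul_apply,
      LinearMap.smul_apply, Module.End.one_apply, Pi.smul_apply, smul_eq_mul, ne_eq,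
      mul_eq_zero, not_or] at hα
    by_cases h : ∃ β : ZS s, (2 : ℤ) • β = α
    · obtain ⟨β, rfl⟩ := h
      rw [upsample_two_smul] at hα
      rw [map_zsmul, hc β hα.2, smul_zero]
    · exact absurd (upsample_of_notMem c h) hα.2
  | insert k K hk ih =>
    have hK' : ∀ l ∈ K, L (θ l) = 0 := fun l hl => hK l (Finset.mem_insert_of_mem hl)
    rw [subdivision_boxMask_insert θ hk] at hα
    simp only [LinearMap.smul_apply, Module.End.mul_apply, LinearMap.add_apply,
      Module.End.one_apply, Pi.smul_apply, Pi.add_apply, translation_apply, smul_eq_mul] at hα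
    by_cases h : subdivision (boxMask θ K) c α = 0
    · rw [h, zero_add] at hα
      have := ih hK' (α - θ k) (right_ne_zero_of_mul hα)
      rwa [map_sub, hK k (Finset.mem_insert_self k K), sub_zero] at this
    · exact ih hK' α h

lemma sum_range_two_mul {M : Type*} [AddCommMonoid M] (g : ℕ → M) (N : ℕ) :
    ∑ i ∈ Finset.range (2 * N), g i = ∑ i ∈ Finset.range N, (g (2 * i) + g (2 * i + 1)) := by
  induction N with
  | zero => simp
  | succ N ih =>
    rw [mul_add, mul_one, Finset.sum_range_succ, Finset.sum_range_succ, Finset.sum_range_succ, ih,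
      add_assoc]

lemma translation_mul {s : ℕ} (θ η : ZS s) :
    translation θ * translation η = translation (θ + η) := by
  ext d α
  simp [sub_sub]

/-- If all directions but one lie in a hyperplane, the iterated mask is constant along the
remaining direction until it drops to zero. -/
lemma subdivision_pow_delta_eq_sum {s n : ℕ} (θ : Fin n → ZS s) (L : ZS s →+ ℝ) {k : Fin n}
    (hL : ∀ l, l ≠ k → L (θ l) = 0) (m : ℕ) :
    ∃ c : ZS s → ℝ, (∀ α, c α ≠ 0 → L α = 0) ∧
      (subdivision (boxMask θ univ) ^ m) (Pi.single 0 1) =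
        ∑ i ∈ Finset.range (2 ^ m), translation ((i : ℤ) • θ k) c := by
  induction m with
  | zero =>
    refine ⟨Pi.single 0 1, fun α hα => ?_, ?_⟩
    · have : α = 0 := by
        by_contra h
        simp [h] at hα
      rw [this, map_zero]
    · ext α
      simp
  | succ m ih =>
    obtain ⟨c, hc, hm⟩ := ih
    have hk : k ∉ univ.erase k := Finset.notMem_erase k univ
    refine ⟨(1 / 2 : ℝ) • subdivision (boxMask θ (univ.erase k)) c, fun α hα => ?_, ?_⟩
    · refine subdivision_boxMask_support θ L (K := univ.erase k)
        (fun l hl => hL l (Finset.ne_of_mem_erase hl)) hc α ?_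
      exact right_ne_zero_of_mul (a := (1 / 2 : ℝ)) hα
    · rw [pow_succ', Module.End.mul_apply, hm, pow_succ', sum_range_two_mul, map_sum]
      refine Finset.sum_congr rfl fun i _ => ?_
      rw [← Finset.insert_erase (Finset.mem_univ k), subdivision_boxMask_insert θ hk,
        Finset.insert_erase (Finset.mem_univ k), ← Module.End.mul_apply, smul_mul_assoc, mul_assoc,
        subdivision_translation, ← mul_assoc, add_mul, one_mul, translation_mul, map_smul,
        map_smul, ← smul_add, smul_smul, LinearMap.smul_apply, Module.End.mul_apply,
        LinearMap.add_apply]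
      congr 3
      push_cast
      rw [add_smul, one_smul, add_comm]

lemma subdivision_pow_delta_along {s n : ℕ} (θ : Fin n → ZS s) (L : ZS s →+ ℝ) {k : Fin n}
    (hL : ∀ l, l ≠ k → L (θ l) = 0) (hLk : L (θ k) = 1) (m : ℕ) (α : ZS s)
    (hα : (subdivision (boxMask θ univ) ^ m) (Pi.single 0 1) α ≠ 0) :
    0 ≤ L α ∧ (subdivision (boxMask θ univ) ^ m) (Pi.single 0 1) α =
      (subdivision (boxMask θ univ) ^ m) (Pi.single 0 1) (α - ⌊L α⌋ • θ k) := by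
  obtain ⟨c, hc, hm⟩ := subdivision_pow_delta_eq_sum θ L hL m
  rw [hm] at hα ⊢
  simp only [Finset.sum_apply, translation_apply] at hα ⊢
  obtain ⟨j, hj, hcj⟩ := Finset.exists_ne_zero_of_sum_ne_zero hα
  have hval : ∀ i : ℕ, L (α - (i : ℤ) • θ k) = L α - i := fun i => by
    rw [map_sub, map_zsmul, hLk, natCast_zsmul, nsmul_one]
  have hLα : L α = j := by
    have := hc _ hcj
    rw [hval] at this
    linarith
  refine ⟨by rw [hLα]; positivity, ?_⟩
  rw [Finset.sum_eq_single j, Finset.sum_eq_single 0]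
  · rw [hLα]
    simp
  · intro i _ hi
    by_contra h
    have := hc _ h
    rw [map_sub, map_zsmul, hLk, hLα, Int.floor_natCast] at this
    simp only [map_sub, map_zsmul, hLk, hLα] at this
    simp at this
    exact hi this
  · intro h
    exact absurd (Finset.mem_range.2 (by positivity)) h
  · intro i _ hi
    by_contra h
    have := hc _ h
    rw [hval, hLα, sub_eq_zero] at this
    exact hi (by exact_mod_cast this.symm)
  · exact fun h => absurd hj h

lemma tendsto_floor_div_two_pow {x : ℕ → ℝ} {y : ℝ}
    (h : Tendsto (fun m => x m / 2 ^ m) atTop (nhds y)) :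
    Tendsto (fun m => (⌊x m⌋ : ℝ) / 2 ^ m) atTop (nhds y) := by
  have h2 : Tendsto (fun m : ℕ => x m / 2 ^ m - 1 / 2 ^ m) atTop (nhds y) := by
    simpa using h.sub (tendsto_const_div_two_pow 1)
  refine tendsto_of_tendsto_of_tendsto_of_le_of_le h2 h (fun m => ?_) fun m => ?_
  · dsimp only
    rw [← sub_div]
    gcongr
    exact (Int.sub_one_lt_floor _).le
  · dsimp only
    gcongr
    exact Int.floor_le _

/-- A nonzero continuous box limit forces the directions to span after deleting any one. -/
lemma span_compl_singleton_eq_top {s n : ℕ} {θ : Fin n → ZS s}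
    (hrank : Submodule.span ℝ (Set.range fun k => fun i => ((θ k i : ℝ))) = ⊤)
    {ψ : (Fin s → ℝ) → ℝ} (h : IteratesTendTo (boxMask θ univ) (Pi.single 0 1) ψ)
    {y : Fin s → ℝ} (hy : ψ y ≠ 0) (k : Fin n) :
    Submodule.span ℝ ((fun l => fun i => ((θ l i : ℝ))) '' {l | l ≠ k}) = ⊤ := by
  by_contra hspan
  obtain ⟨f, hf0, hf⟩ := Submodule.exists_le_ker_of_lt_top _ (lt_top_iff_ne_top.2 hspan)
  have hfl : ∀ l, l ≠ k → f (fun i => (θ l i : ℝ)) = 0 := fun l hl =>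
    hf (Submodule.subset_span ⟨l, hl, rfl⟩)
  have hfk : f (fun i => (θ k i : ℝ)) ≠ 0 := by
    intro hk
    refine hf0 (LinearMap.ker_eq_top.1 (top_le_iff.1 ?_))
    rw [← hrank, Submodule.span_le]
    rintro _ ⟨l, rfl⟩
    by_cases hl : l = k
    · exact hl ▸ hk
    · exact hfl l hl
  set w : (Fin s → ℝ) →ₗ[ℝ] ℝ := (f (fun i => (θ k i : ℝ)))⁻¹ • f with hw
  let L : ZS s →+ ℝ := w.toAddMonoidHom.comp ((Int.castAddHom ℝ).compLeft (Fin s))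
  have hLw : ∀ α : ZS s, L α = w (fun i => (α i : ℝ)) := fun α => rfl
  have hL : ∀ l, l ≠ k → L (θ l) = 0 := fun l hl => by
    rw [hLw, hw, LinearMap.smul_apply, hfl l hl, smul_zero]
  have hLk : L (θ k) = 1 := by
    rw [hLw, hw, LinearMap.smul_apply, smul_eq_mul, inv_mul_cancel₀ hfk]
  have hwc : Continuous w := w.continuous_of_finiteDimensional
  set α : ℕ → ZS s := fun m i => ⌊2 ^ m * y i⌋
  have hα : ScaledTendsto α y := scaledTendsto_floor y
  have hLα : Tendsto (fun m => L (α m) / 2 ^ m) atTop (nhds (w y)) := by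
    refine ((hwc.tendsto y).comp (tendsto_pi_nhds.2 hα)).congr fun m => ?_
    rw [hLw, div_eq_inv_mul, ← smul_eq_mul, ← map_smul]
    simp only [Function.comp_apply]
    congr 1
    funext i
    simp [div_eq_inv_mul]
  have hc : Tendsto (fun m => ((-⌊L (α m)⌋ : ℤ) : ℝ) / 2 ^ m) atTop (nhds (-w y)) := by
    simpa [neg_div] using (tendsto_floor_div_two_pow hLα).neg
  have hβ := hα.add (scaledTendsto_smul hc (θ k))
  have hγ := hβ.add (scaledTendsto_const (-θ k))
  rw [add_zero] at hγ
  have hψβ := h _ _ hβ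
  have hψγ := h _ _ hγ
  have hzero : ∀ m, (subdivision (boxMask θ univ) ^ m) (Pi.single 0 1)
      (α m + (-⌊L (α m)⌋) • θ k + -θ k) = 0 := by
    intro m
    by_contra hne
    have h0 := (subdivision_pow_delta_along θ L hL hLk m _ hne).1
    rw [map_add, map_add, map_neg, map_zsmul, hLk] at h0
    have h1 := Int.lt_floor_add_one (L (α m))
    simp at h0
    linarith
  simp only [hzero] at hψγ
  rw [← tendsto_nhds_unique tendsto_const_nhds hψγ] at hψβ
  refine hy (tendsto_nhds_unique (h _ _ hα) (squeeze_zero_norm (fun m => ?_) (hψβ.norm.trans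
    (by rw [norm_zero]))))
  by_cases hne : (subdivision (boxMask θ univ) ^ m) (Pi.single 0 1) (α m) = 0
  · rw [hne, norm_zero]
    exact norm_nonneg _
  · rw [neg_smul, ← sub_eq_add_neg, (subdivision_pow_delta_along θ L hL hLk m _ hne).2]

lemma Bdd.subdivision {s : ℕ} (P : AddMonoidAlgebra ℝ (ZS s)) {d : ZS s → ℝ} (hd : Bdd d) :
    Bdd (subdivision P d) := by
  obtain ⟨C, hC⟩ := hd
  have hU : ∀ α, |upsample d α| ≤ C := fun α => by
    by_cases h : ∃ β : ZS s, (2 : ℤ) • β = α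
    · obtain ⟨β, rfl⟩ := h
      rw [upsample_two_smul]
      exact hC β
    · rw [upsample_of_notMem d h, abs_zero]
      exact (abs_nonneg _).trans (hC 0)
  refine ⟨∑ γ ∈ P.coeff.support, |P.coeff γ| * C, fun α => ?_⟩
  rw [_root_.subdivision, Module.End.mul_apply, maskConv_apply]
  refine (Finset.abs_sum_le_sum_abs _ _).trans (Finset.sum_le_sum fun γ _ => ?_)
  rw [abs_mul]
  exact mul_le_mul_of_nonneg_left (hU _) (abs_nonneg _)

lemma Bdd.subdivision_pow {s : ℕ} (P : AddMonoidAlgebra ℝ (ZS s)) {d : ZS s → ℝ} (hd : Bdd d)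
    (m : ℕ) : Bdd ((_root_.subdivision P ^ m) d) := by
  induction m with
  | zero => exact hd
  | succ m ih =>
    rw [pow_succ', Module.End.mul_apply]
    exact ih.subdivision P

lemma Bdd.add {s : ℕ} {d e : ZS s → ℝ} (hd : Bdd d) (he : Bdd e) : Bdd (d + e) := by
  obtain ⟨C, hC⟩ := hd
  obtain ⟨D, hD⟩ := he
  exact ⟨C + D, fun α => (abs_add_le _ _).trans (add_le_add (hC α) (hD α))⟩

lemma Bdd.smul {s : ℕ} {d : ZS s → ℝ} (hd : Bdd d) (c : ℝ) : Bdd (c • d) := by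
  obtain ⟨C, hC⟩ := hd
  refine ⟨|c| * C, fun α => ?_⟩
  rw [Pi.smul_apply, smul_eq_mul, abs_mul]
  exact mul_le_mul_of_nonneg_left (hC α) (abs_nonneg _)

lemma bdd_one {s : ℕ} : Bdd (1 : ZS s → ℝ) := ⟨1, fun α => by simp⟩

/-- The oscillation caused by the direction `θ^k`: it measures how far the mask without `θ^k`
is from satisfying the sum rule. -/
def directionDefect {s n : ℕ} (θ : Fin n → ZS s) (k : Fin n) : ZS s → ℝ :=
  translation (θ k) (subdivision (boxMask θ (univ.erase k)) 1) - 1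

lemma bdd_directionDefect {s n : ℕ} (θ : Fin n → ZS s) (k : Fin n) :
    Bdd (directionDefect θ k) := by
  obtain ⟨C, hC⟩ := (bdd_one (s := s)).subdivision (boxMask θ (univ.erase k))
  refine ⟨C + 1, fun α => (abs_sub _ _).trans (add_le_add (hC _) ?_)⟩
  simp

lemma translation_directionDefect_of_ne {s n : ℕ} (θ : Fin n → ZS s) {k l : Fin n}
    (hl : l ≠ k) : translation (θ l) (directionDefect θ k) = directionDefect θ k := by
  set K := (univ.erase k).erase l
  have hK : insert l K = univ.erase k :=
    Finset.insert_erase (Finset.mem_erase.2 ⟨hl, Finset.mem_univ l⟩)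
  have h := sub_translation_mul_subdivision_insert θ
    (Finset.notMem_erase l (univ.erase k))
  rw [hK] at h
  have h1 := LinearMap.congr_fun h 1
  have h2 : ∀ η : ZS s, translation η (1 : ZS s → ℝ) = 1 := fun η => rfl
  simp only [Module.End.mul_apply, LinearMap.smul_apply, LinearMap.sub_apply,
    Module.End.one_apply, h2, sub_self, map_zero, smul_zero] at h1
  rw [directionDefect, map_sub, h2, ← Module.End.mul_apply, translation_mul, add_comm,
    ← translation_mul, Module.End.mul_apply, ← sub_eq_zero.1 h1]

lemma translation_directionDefect_self {s n : ℕ} (θ : Fin n → ZS s)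
    (h1 : subdivision (boxMask θ univ) 1 = 1) (k : Fin n) :
    translation (θ k) (directionDefect θ k) = -directionDefect θ k := by
  have h := subdivision_boxMask_insert θ (Finset.notMem_erase k univ)
  rw [Finset.insert_erase (Finset.mem_univ k)] at h
  rw [h] at h1
  funext α
  have h2 := congr_fun h1 (α - θ k)
  simp only [LinearMap.smul_apply, Module.End.mul_apply, LinearMap.add_apply,
      Module.End.one_apply, Pi.smul_apply, Pi.add_apply, translation_apply, smul_eq_mul,
      Pi.one_apply] at h2
  simp only [directionDefect, Pi.sub_apply, Pi.neg_apply, translation_apply,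
    Pi.one_apply]
  linarith

lemma translation_subdivision_pow_of_fixed {s n : ℕ} (θ : Fin n → ZS s) {l : Fin n}
    {d : ZS s → ℝ} (hd : translation (θ l) d = d) (m : ℕ) :
    translation (θ l) ((subdivision (boxMask θ univ) ^ m) d) =
      (subdivision (boxMask θ univ) ^ m) d := by
  induction m with
  | zero => exact hd
  | succ m ih =>
    have h := LinearMap.congr_fun
      (sub_translation_mul_subdivision_insert θ (Finset.notMem_erase l univ))
      ((subdivision (boxMask θ univ) ^ m) d)
    rw [Finset.insert_erase (Finset.mem_univ l)] at h
    simp only [Module.End.mul_apply, LinearMap.smul_apply, LinearMap.sub_apply,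
      Module.End.one_apply, ih, sub_self, map_zero, smul_zero] at h
    rw [pow_succ', Module.End.mul_apply]
    exact (sub_eq_zero.1 h).symm

lemma apply_add_zsmul_of_translation_eq {s : ℕ} {θ : ZS s} {f : ZS s → ℝ}
    (hf : translation θ f = f) (c : ℤ) (α : ZS s) : f (α + c • θ) = f α := by
  have h : ∀ β, f (β - θ) = f β := fun β => congr_fun hf β
  have : Function.Periodic f θ := fun β => by
    rw [← h (β + θ), add_sub_cancel_right]
  exact this.zsmul c α

lemma directionDefect_limit_eq_zero {s n : ℕ} {θ : Fin n → ZS s} {k : Fin n}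
    (hspan : Submodule.span ℝ ((fun l => fun i => ((θ l i : ℝ))) '' {l | l ≠ k}) = ⊤)
    (h1 : subdivision (boxMask θ univ) 1 = 1)
    {ψ : (Fin s → ℝ) → ℝ} (h : IteratesTendTo (boxMask θ univ) (directionDefect θ k) ψ)
    (y : Fin s → ℝ) : ψ y = 0 := by
  have hconst : ∀ v : Fin s → ℝ, ∀ (c : ℝ) (y : Fin s → ℝ), ψ (y + c • v) = ψ y := by
    intro v
    have hv : v ∈ Submodule.span ℝ ((fun l => fun i => ((θ l i : ℝ))) '' {l | l ≠ k}) :=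
      hspan ▸ Submodule.mem_top
    induction hv using Submodule.span_induction with
    | mem v hv =>
      obtain ⟨l, hl, rfl⟩ := hv
      intro c y
      have hy := scaledTendsto_floor y
      have hadd := hy.add (scaledTendsto_smul (tendsto_floor_two_pow c) (θ l))
      refine tendsto_nhds_unique ((h _ _ hadd).congr fun m => ?_) (h _ _ hy)
      exact apply_add_zsmul_of_translation_eq
        (translation_subdivision_pow_of_fixed θ (translation_directionDefect_of_ne θ hl) m) _ _
    | zero => simp
    | add u v _ _ hu hv =>
      intro c y
      rw [smul_add, ← add_assoc, hv, hu]
    | smul b v _ hv =>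
      intro c y
      rw [smul_smul, hv]
  have hy := scaledTendsto_floor y
  have hc : Tendsto (fun m : ℕ => ((-2 ^ m : ℤ) : ℝ) / 2 ^ m) atTop (nhds (-1)) := by
    refine tendsto_const_nhds.congr fun m => ?_
    push_cast
    field_simp
  have hadd := hy.add (scaledTendsto_smul hc (θ k))
  have hneg : ψ (y + fun i => -1 * (θ k i : ℝ)) = -ψ y := by
    refine tendsto_nhds_unique ((h _ _ hadd).congr fun m => ?_) (h _ _ hy).neg
    have h2 := congr_fun (LinearMap.congr_fun
      (subdivision_pow_translation (boxMask θ univ) m (θ k)) (directionDefect θ k))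
      (fun i => ⌊2 ^ m * y i⌋)
    rw [Module.End.mul_apply, translation_directionDefect_self θ h1, map_neg] at h2
    rw [neg_smul, ← sub_eq_add_neg]
    exact h2.symm
  have h3 := hconst (fun i => (θ k i : ℝ)) (-1) y
  have h4 : ((-1 : ℝ) • fun i => (θ k i : ℝ)) = fun i => -1 * (θ k i : ℝ) := rfl
  rw [h4, hneg] at h3
  linarith

/-- Multiplication of a sequence by its `i`-th index. -/
def indexMul {s : ℕ} (i : Fin s) : Module.End ℝ (ZS s → ℝ) :=
  LinearMap.mulLeft ℝ (fun α : ZS s => (α i : ℝ))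

@[simp] lemma indexMul_apply {s : ℕ} (i : Fin s) (d : ZS s → ℝ) (α : ZS s) :
    indexMul i d α = α i * d α := rfl

lemma upsample_mul_indexMul {s : ℕ} (i : Fin s) :
    upsample * indexMul i = (1 / 2 : ℝ) • (indexMul i * upsample) := by
  ext d α
  simp only [Module.End.mul_apply, LinearMap.smul_apply, Pi.smul_apply, indexMul_apply,
    smul_eq_mul]
  by_cases h : ∃ β : ZS s, (2 : ℤ) • β = α
  · obtain ⟨β, rfl⟩ := h
    rw [upsample_two_smul, upsample_two_smul, indexMul_apply]
    simp
    ring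
  · rw [upsample_of_notMem _ h, upsample_of_notMem _ h]
    simp

lemma translation_mul_indexMul {s : ℕ} (θ : ZS s) (i : Fin s) :
    translation θ * indexMul i = indexMul i * translation θ - (θ i : ℝ) • translation θ := by
  ext d α
  simp
  ring

lemma subdivision_mul_indexMul {s n : ℕ} (θ : Fin n → ZS s) (K : Finset (Fin n)) (i : Fin s) :
    subdivision (boxMask θ K) * indexMul i =
      (1 / 2 : ℝ) • (indexMul i * subdivision (boxMask θ K)) -
      (1 / 4 : ℝ) • ∑ k ∈ K, (θ k i : ℝ) •
        (translation (θ k) * subdivision (boxMask θ (K.erase k))) := by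
  induction K using Finset.induction_on with
  | empty =>
    simp [subdivision, boxMask, upsample_mul_indexMul, smul_smul, mul_comm]
  | insert k K hk ih =>
    have hsum : ∀ l ∈ K, (θ l i : ℝ) •
        (translation (θ l) * subdivision (boxMask θ ((insert k K).erase l))) =
        (1 / 2 : ℝ) • ((1 + translation (θ k)) * ((θ l i : ℝ) •
          (translation (θ l) * subdivision (boxMask θ (K.erase l))))) := by
      intro l hl
      have hne : k ≠ l := fun h => hk (h ▸ hl)
      have hcomm : translation (θ l) * (1 + translation (θ k)) =
          (1 + translation (θ k)) * translation (θ l) := by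
        rw [mul_add, add_mul, mul_one, one_mul, translation_mul, translation_mul, add_comm (θ l)]
      rw [Finset.erase_insert_of_ne hne, subdivision_boxMask_insert θ
        (fun h => hk (Finset.mem_of_mem_erase h)), mul_smul_comm, mul_smul_comm, smul_comm,
        ← mul_assoc, ← mul_assoc, hcomm]
    rw [Finset.sum_insert hk, Finset.erase_insert hk, Finset.sum_congr rfl hsum,
      ← Finset.smul_sum, ← Finset.mul_sum, subdivision_boxMask_insert θ hk, smul_mul_assoc,
      mul_assoc, ih, mul_sub, mul_smul_comm, mul_smul_comm]
    generalize (1 + translation (θ k)) * ∑ l ∈ K, (θ l i : ℝ) •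
      (translation (θ l) * subdivision (boxMask θ (K.erase l))) = A
    have h : (1 + translation (θ k)) * (indexMul i * subdivision (boxMask θ K)) =
        indexMul i * ((1 + translation (θ k)) * subdivision (boxMask θ K)) -
          (θ k i : ℝ) • (translation (θ k) * subdivision (boxMask θ K)) := by
      simp only [← mul_assoc, add_mul, mul_add, one_mul, translation_mul_indexMul,
        sub_mul, smul_mul_assoc]
      abel
    rw [h, mul_smul_comm]
    module

/-- The subdivision iterates of `d` approach the samples of `p` at the parameter values,
uniformly over the lattice. -/
def ApproachesSamples {s : ℕ} (P : AddMonoidAlgebra ℝ (ZS s)) (τ : Fin s → ℝ) (d : ZS s → ℝ)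
    (p : (Fin s → ℝ) → ℝ) : Prop :=
  ∀ ε > 0, ∀ᶠ r in atTop, ∀ α, |(subdivision P ^ r) d α - p (param 2 τ r α)| < ε

namespace ApproachesSamples

variable {s : ℕ} {P : AddMonoidAlgebra ℝ (ZS s)} {τ : Fin s → ℝ}

lemma zero : ApproachesSamples P τ 0 0 := fun ε hε => by simp [hε]

lemma one (h1 : subdivision P 1 = 1) : ApproachesSamples P τ 1 1 := fun ε hε => by
  refine Eventually.of_forall fun r α => ?_
  rw [Module.End.pow_apply, Function.iterate_fixed h1]
  simpa using hε

lemma add {d e : ZS s → ℝ} {p q : (Fin s → ℝ) → ℝ} (hd : ApproachesSamples P τ d p)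
    (he : ApproachesSamples P τ e q) : ApproachesSamples P τ (d + e) (p + q) := fun ε hε => by
  filter_upwards [hd (ε / 2) (half_pos hε), he (ε / 2) (half_pos hε)] with r h1 h2 α
  rw [map_add, Pi.add_apply, Pi.add_apply, add_sub_add_comm]
  exact (abs_add_le _ _).trans_lt (by linarith [h1 α, h2 α])

lemma smul {d : ZS s → ℝ} {p : (Fin s → ℝ) → ℝ} (hd : ApproachesSamples P τ d p) (c : ℝ) :
    ApproachesSamples P τ (c • d) (c • p) := fun ε hε => by
  have hc : 0 < |c| + 1 := by positivity
  filter_upwards [hd (ε / (|c| + 1)) (div_pos hε hc)] with r h α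
  rw [map_smul, Pi.smul_apply, Pi.smul_apply, ← smul_sub, smul_eq_mul, abs_mul]
  have h2 := h α
  rw [lt_div_iff₀ hc] at h2
  nlinarith [abs_nonneg ((subdivision P ^ r) d α - p (param 2 τ r α))]

lemma sum {ι : Type*} {K : Finset ι} {d : ι → ZS s → ℝ} {p : ι → (Fin s → ℝ) → ℝ}
    (h : ∀ k ∈ K, ApproachesSamples P τ (d k) (p k)) :
    ApproachesSamples P τ (∑ k ∈ K, d k) (∑ k ∈ K, p k) := by
  induction K using Finset.cons_induction with
  | empty => exact zero
  | cons k K hk ih =>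
    rw [Finset.sum_cons, Finset.sum_cons]
    exact (h k (Finset.mem_cons_self k K)).add
      (ih fun l hl => h l (Finset.mem_cons_of_mem hl))

end ApproachesSamples

lemma eventually_abs_lt_of_half_recursion {ι : Type*} {E h : ℕ → ι → ℝ}
    (hE : ∃ C, ∀ α, |E 0 α| ≤ C) (hrec : ∀ r α, E (r + 1) α = 1 / 2 * E r α + h r α)
    (hb : ∀ r, ∃ C, ∀ α, |h r α| ≤ C) (hh : ∀ ε > 0, ∀ᶠ r in atTop, ∀ α, |h r α| < ε)
    {ε : ℝ} (hε : 0 < ε) : ∀ᶠ r in atTop, ∀ α, |E r α| < ε := by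
  have hbound : ∀ r, ∃ C, ∀ α, |E r α| ≤ C := by
    intro r
    induction r with
    | zero => exact hE
    | succ r ih =>
      obtain ⟨C, hC⟩ := ih
      obtain ⟨D, hD⟩ := hb r
      refine ⟨1 / 2 * C + D, fun α => ?_⟩
      rw [hrec]
      refine (abs_add_le _ _).trans ?_
      rw [abs_mul, abs_of_pos (one_half_pos (α := ℝ))]
      linarith [hC α, hD α]
  obtain ⟨M, hM⟩ := eventually_atTop.1 (hh (ε / 4) (by positivity))
  obtain ⟨C, hC⟩ := hbound M
  have hdecay : ∀ j α, |E (M + j) α| ≤ C / 2 ^ j + ε / 2 := by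
    intro j α
    induction j with
    | zero =>
      have := hC α
      simp only [add_zero, pow_zero, div_one]
      linarith
    | succ j ih =>
      rw [← add_assoc, hrec, pow_succ, ← div_div]
      refine (abs_add_le _ _).trans ?_
      rw [abs_mul, abs_of_pos (one_half_pos (α := ℝ))]
      linarith [hM (M + j) (Nat.le_add_right M j) α]
  obtain ⟨J, hJ⟩ := eventually_atTop.1
    ((tendsto_const_div_two_pow C).eventually (gt_mem_nhds (half_pos hε)))
  refine eventually_atTop.2 ⟨M + J, fun r hr α => ?_⟩
  obtain ⟨j, rfl⟩ := Nat.exists_eq_add_of_le ((Nat.le_add_right M J).trans hr)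
  linarith [hdecay j α, hJ j (by omega)]

lemma approachesSamples_coord {s n : ℕ} {θ : Fin n → ZS s} {τ : Fin s → ℝ}
    (hτ : ∀ i, τ i = (1 / 2) * ∑ k, (θ k i : ℝ))
    (h1 : subdivision (boxMask θ univ) 1 = 1)
    (hθ : ∀ k, ApproachesSamples (boxMask θ univ) τ (directionDefect θ k) 0) (i : Fin s) :
    ApproachesSamples (boxMask θ univ) τ (fun α => (α i : ℝ)) (fun x => x i) := by
  set v : ZS s → ℝ := ∑ k, (-(1 / 4) * (θ k i : ℝ)) • directionDefect θ k with hv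
  have hvb : Bdd v := by
    rw [hv]
    refine Finset.sum_induction _ Bdd (fun _ _ => Bdd.add) ⟨0, by simp⟩ fun k _ =>
      (bdd_directionDefect θ k).smul _
  have hv0 : ApproachesSamples (boxMask θ univ) τ v 0 := by
    have := ApproachesSamples.sum (K := univ) fun k _ => (hθ k).smul (-(1 / 4) * (θ k i : ℝ))
    simpa only [smul_zero, Finset.sum_const_zero] using this
  have hS1 : ∀ r, (subdivision (boxMask θ univ) ^ r) 1 = 1 := fun r => by
    rw [Module.End.pow_apply, Function.iterate_fixed h1]
  have hSx : subdivision (boxMask θ univ) (fun α => (α i : ℝ)) =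
      (1 / 2 : ℝ) • (fun α : ZS s => (α i : ℝ)) - (1 / 2 * τ i) • 1 + v := by
    have hx : indexMul i 1 = fun α : ZS s => (α i : ℝ) := by
      ext α
      simp
    have h := LinearMap.congr_fun (subdivision_mul_indexMul θ univ i) 1
    simp only [Module.End.mul_apply, LinearMap.sub_apply, LinearMap.smul_apply,
      LinearMap.sum_apply, h1, hx] at h
    have hd : ∀ k, translation (θ k) (subdivision (boxMask θ (univ.erase k)) 1) =
        directionDefect θ k + 1 := fun k => by rw [directionDefect, sub_add_cancel]
    simp only [hd, smul_add, Finset.sum_add_distrib, ← Finset.sum_smul] at h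
    rw [h, hv, hτ, ← sub_sub, Finset.smul_sum]
    simp only [smul_smul, neg_mul, neg_smul, Finset.sum_neg_distrib]
    module
  refine fun ε hε => eventually_abs_lt_of_half_recursion
    (E := fun r α => (subdivision (boxMask θ univ) ^ r) (fun α => (α i : ℝ)) α - param 2 τ r α i)
    (h := fun r => (subdivision (boxMask θ univ) ^ r) v) ⟨0, fun α => ?_⟩ (fun r α => ?_)
    (fun r => hvb.subdivision_pow _ r) (fun ε hε => ?_) hε
  · simp [param_two]
  · rw [pow_succ, Module.End.mul_apply, hSx, map_add, map_sub, map_smul, map_smul, hS1,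
      param_two, param_two]
    simp only [Pi.add_apply, Pi.sub_apply, Pi.smul_apply, Pi.one_apply, smul_eq_mul, pow_succ]
    field_simp
    ring
  · simpa using hv0 ε hε

lemma ApproachesSamples.linear {s : ℕ} {P : AddMonoidAlgebra ℝ (ZS s)} {τ : Fin s → ℝ}
    (h1 : subdivision P 1 = 1)
    (hx : ∀ i, ApproachesSamples P τ (fun α => (α i : ℝ)) (fun x => x i))
    {p : MvPolynomial (Fin s) ℝ} (hp : p.totalDegree ≤ 1) :
    ApproachesSamples P τ (fun α => MvPolynomial.eval (fun i => (α i : ℝ)) p)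
      (fun x => MvPolynomial.eval x p) := by
  have hmon : ∀ v ∈ p.support, ApproachesSamples P τ
      (fun α => ∏ i, (α i : ℝ) ^ v i) (fun x => ∏ i, x i ^ v i) := by
    intro v hv
    have hdeg := (MvPolynomial.le_totalDegree hv).trans hp
    rcases Nat.le_one_iff_eq_zero_or_eq_one.1 hdeg with h0 | h0
    · have : v = 0 := (Finsupp.degree_eq_zero_iff v).1 h0
      subst this
      simpa using! ApproachesSamples.one h1
    · obtain ⟨i, rfl⟩ := (Finsupp.sum_eq_one_iff v).1 h0
      have hprod : ∀ x : Fin s → ℝ, ∏ j, x j ^ (Finsupp.single i 1 : Fin s →₀ ℕ) j = x i := by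
        intro x
        rw [Finset.prod_eq_single i] <;> simp +contextual [eq_comm]
      simp only [hprod]
      exact hx i
  have h := ApproachesSamples.sum fun v hv => (hmon v hv).smul (p.coeff v)
  convert h using 1
  · ext α
    simp [MvPolynomial.eval_eq']
  · ext x
    simp [MvPolynomial.eval_eq']

/-- Lattice data extend to continuous functions without increasing the bound. -/
lemma exists_continuous_extension {s : ℕ} (E : ZS s → ℝ) :
    ∃ G : (Fin s → ℝ) → ℝ, Continuous G ∧ (∀ α : ZS s, G (fun i => (α i : ℝ)) = E α) ∧
      ∀ η, (∀ α, |E α| ≤ η) → ∀ x, |G x| ≤ η := by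
  have he : Topology.IsClosedEmbedding (fun (α : ZS s) (i : Fin s) => (α i : ℝ)) :=
    Topology.IsClosedEmbedding.piMap fun _ => Int.isClosedEmbedding_coe_real
  by_cases hE : Bdd E
  · obtain ⟨C, hC⟩ := hE
    let f : BoundedContinuousFunction (ZS s) ℝ :=
      BoundedContinuousFunction.ofNormedAddCommGroup E continuous_of_discreteTopology C hC
    obtain ⟨g, hg, hgf⟩ :=
      BoundedContinuousFunction.exists_extension_norm_eq_of_isClosedEmbedding f he
    refine ⟨g, g.continuous, fun α => congr_fun hgf α, fun η hη x => ?_⟩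
    refine (g.norm_coe_le_norm x).trans (hg.trans_le ?_)
    exact (BoundedContinuousFunction.norm_le ((abs_nonneg _).trans (hη 0))).2 hη
  · obtain ⟨g, hg⟩ := ContinuousMap.exists_extension he ⟨E, continuous_of_discreteTopology⟩
    exact ⟨g, g.continuous, fun α => DFunLike.congr_fun hg α, fun η hη => absurd ⟨η, hη⟩ hE⟩

lemma ApproachesSamples.convergesTo {s : ℕ} {P : AddMonoidAlgebra ℝ (ZS s)} {τ : Fin s → ℝ}
    {d : ZS s → ℝ} {p : (Fin s → ℝ) → ℝ} (h : ApproachesSamples P τ d p) (hp : Continuous p) :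
    ConvergesTo 2 (fun α => P.coeff α) τ d p := by
  choose G hGc hGE hGb using fun r =>
    exists_continuous_extension fun α => (subdivision P ^ r) d α - p (param 2 τ r α)
  refine ⟨fun r x => p x + G r (fun i => 2 ^ r * (x i + τ i) - τ i), fun r => ?_,
    fun r α => ?_, ?_⟩
  · have := hGc r
    fun_prop
  · have hα : (fun i => 2 ^ r * (param 2 τ r α i + τ i) - τ i) = fun i => (α i : ℝ) := by
      funext i
      rw [param_two]
      field_simp
      ring
    dsimp only
    rw [hα, hGE, add_sub_cancel, subdOp_eq_subdivision, Module.End.pow_apply]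
  · refine Metric.tendstoUniformly_iff.2 fun ε hε => ?_
    filter_upwards [h (ε / 2) (half_pos hε)] with r hr x
    rw [dist_self_add_right, Real.norm_eq_abs]
    exact (hGb r _ (fun α => (hr α).le) _).trans_lt (half_lt_self hε)

/-- A convergent box spline subdivision scheme (dilation `2I`), with symbol
`a_Θ(z) = 2^s ∏_{k}(1+z^{θ^k})/2` for an `s × n` integer matrix `Θ` of rank `s`, `n ≥ s`,
reproduces linear polynomials with the parametrization offset
`τ = (1/2)(∑_k θ^k_1, …, ∑_k θ^k_s)`. -/
theorem stmt13 {s n : ℕ} (hs : 1 ≤ s) (hn : s ≤ n)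
    (θ : Fin n → ZS s)
    (hrank : Submodule.span ℝ (Set.range fun k => fun i => ((θ k i : ℝ))) = ⊤)
    (a : ZS s → ℝ) (ha : (Function.support a).Finite)
    (hsymb : ∀ z : Fin s → ℂ, (∀ i, z i ≠ 0) →
      symbolD a 0 z = 2 ^ s * ∏ k, (1 + zpowV z (θ k)) / 2)
    (τ : Fin s → ℝ) (hτ : ∀ i, τ i = (1 / 2) * ∑ k, (θ k i : ℝ))
    (hconv : Convergent 2 a τ) :
    Reproduces 2 a τ 1 := by
  obtain rfl := eq_coeff_boxMask θ a ha hsymb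
  have hδ : Bdd (Pi.single 0 1 : ZS s → ℝ) := ⟨1, fun α => by
    by_cases h : α = 0 <;> simp [h]⟩
  obtain ⟨g, hg⟩ := hconv _ hδ
  obtain ⟨y, hy⟩ := exists_ne_zero_of_convergesTo_delta (sum_coeff_boxMask θ univ) hg
  have hy' : g (y + τ - τ) ≠ 0 := by rwa [add_sub_cancel_right]
  have h1 := subdivision_one_of_iteratesTendTo hg.iteratesTendTo hy'
  have hθ : ∀ k, ApproachesSamples (boxMask θ univ) τ (directionDefect θ k) 0 := by
    intro k
    obtain ⟨u, hu⟩ := hconv _ (bdd_directionDefect θ k)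
    have hu0 : ∀ x, u x = 0 := fun x => by
      simpa using directionDefect_limit_eq_zero
        (span_compl_singleton_eq_top hrank hg.iteratesTendTo hy' k) h1 hu.iteratesTendTo (x + τ)
    intro ε hε
    simpa using hu.uniform_of_eq_zero hu0 hε
  exact fun p hp => (ApproachesSamples.linear h1 (approachesSamples_coord hτ h1 hθ) hp).convergesTo
    p.continuous_eval

end
end
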